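/- arXiv:2405.18431 — 6 statements merged into one kernel-verified Lean document; each statement's English description precedes it below -/
import Mathlib

section
/- Let X be a metric space which is not σ-discrete. Then for every positive natural number K and every colouring c assigning to each unordered pair of distinct points of X a colour in {0,…,K−1}, there is Y ⊆ X homeomorphic to ℚ such that c takes at most 2 values on unordered pairs of distinct elements of Y, i.e. |c''[Y]²| ≤ 2. -/
/-- The set of colours taken by the pair-colouring `c` on unordered pairs of
distinct elements of `Y`, i.e. `c''[Y]²`. -/
def pairColours {X : Type*} {K : ℕ} (c : Sym2 X → Fin K) (Y : Set X) : Set (Fin K) :=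
  {k | ∃ x ∈ Y, ∃ y ∈ Y, x ≠ y ∧ c s(x, y) = k}

namespace GalvinMetric

section ClubFilter

open Set Filter

/-- The club filter on the countable subsets of `U`. -/
def club (U : Type*) : Filter (Set U) where
  sets := {C | ∃ g : Finset U → Set U, (∀ s, (g s).Countable) ∧
    ∀ M : Set U, M.Countable → (∀ s : Finset U, (s : Set U) ⊆ M → g s ⊆ M) → M ∈ C}
  univ_sets := ⟨fun _ => ∅, fun _ => countable_empty, fun _ _ _ => mem_univ _⟩
  sets_of_superset := by
    rintro C D ⟨g, hg, h⟩ hCD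
    exact ⟨g, hg, fun M hM hc => hCD (h M hM hc)⟩
  inter_sets := by
    rintro C D ⟨g, hg, h⟩ ⟨g', hg', h'⟩
    exact ⟨fun s => g s ∪ g' s, fun s => (hg s).union (hg' s), fun M hM hc =>
      ⟨h M hM fun s hs => subset_union_left.trans (hc s hs),
        h' M hM fun s hs => subset_union_right.trans (hc s hs)⟩⟩

variable {U : Type*}

theorem mem_club {C : Set (Set U)} : C ∈ club U ↔
    ∃ g : Finset U → Set U, (∀ s, (g s).Countable) ∧
      ∀ M : Set U, M.Countable → (∀ s : Finset U, (s : Set U) ⊆ M → g s ⊆ M) → M ∈ C :=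
  Iff.rfl

instance : CountableInterFilter (club U) := by
  refine ⟨fun S hS h => ?_⟩
  choose! g hg hM using fun C (hC : C ∈ S) => mem_club.1 (h C hC)
  refine mem_club.2 ⟨fun s => ⋃ C ∈ S, g C s, fun s => hS.biUnion fun C hC => hg C hC s, ?_⟩
  intro M hMc hcl C hC
  refine hM C hC M hMc fun s hs => ?_
  exact (subset_biUnion_of_mem (u := fun C => g C s) hC).trans (hcl s hs)

theorem eventually_mem (u : U) : ∀ᶠ M in club U, u ∈ M :=
  mem_club.2 ⟨fun _ => {u}, fun _ => countable_singleton u, fun M _ h => by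
    simpa using h ∅ (by simp)⟩

theorem diag {p : U → Set U → Prop} (h : ∀ u, ∀ᶠ M in club U, p u M) :
    ∀ᶠ M in club U, ∀ u ∈ M, p u M := by
  classical
  choose g hg hM using fun u => mem_club.1 (h u)
  refine mem_club.2 ⟨fun s => ⋃ u ∈ s, ⋃ t ∈ s.powerset, g u t, fun s => ?_, ?_⟩
  · exact (Finset.countable_toSet s).biUnion fun u _ =>
      (Finset.countable_toSet _).biUnion fun t _ => hg u t
  · intro M hMc hcl u hu
    refine hM u M hMc fun t ht => ?_
    refine Subset.trans ?_ (hcl (insert u t) ?_)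
    · intro z hz
      simp only [mem_iUnion]
      exact ⟨u, Finset.mem_insert_self _ _, t, by simp, hz⟩
    · rw [Finset.coe_insert]
      exact insert_subset hu ht

/-- The closure of `S` under the finitary operations `g`. -/
def step (g : Finset U → Set U) (S : Set U) : Set U :=
  S ∪ ⋃ s : {s : Finset U // (s : Set U) ⊆ S}, g s

def cl (g : Finset U → Set U) (S : Set U) : Set U := ⋃ n : ℕ, (step g)^[n] S

def Closed (g : Finset U → Set U) (M : Set U) : Prop :=
  ∀ s : Finset U, (s : Set U) ⊆ M → g s ⊆ M

theorem subset_cl (g : Finset U → Set U) (S : Set U) : S ⊆ cl g S :=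
  subset_iUnion (fun n : ℕ => (step g)^[n] S) 0

theorem step_mono_index (g : Finset U → Set U) (S : Set U) :
    Monotone fun n : ℕ => (step g)^[n] S := by
  refine monotone_nat_of_le_succ fun n => ?_
  rw [Function.iterate_succ_apply']
  exact subset_union_left

/-- A union of a nonempty directed family of closed sets is closed. -/
theorem finset_subset_of_directed {ι : Type*} [Nonempty ι] {A : ι → Set U}
    (hA : Directed (· ⊆ ·) A) (s : Finset U) (hs : (s : Set U) ⊆ ⋃ i, A i) :
    ∃ i, (s : Set U) ⊆ A i :=
  hA.exists_mem_subset_of_finset_subset_biUnion hs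

theorem closed_cl (g : Finset U → Set U) (S : Set U) : Closed g (cl g S) := by
  intro s hs
  obtain ⟨n, hn⟩ := finset_subset_of_directed (step_mono_index g S).directed_le s hs
  refine Subset.trans ?_ (subset_iUnion (fun n : ℕ => (step g)^[n] S) (n + 1))
  simp only [Function.iterate_succ_apply']
  exact (subset_iUnion (fun s : {s : Finset U // (s : Set U) ⊆ _} => g s) ⟨s, hn⟩).trans
    subset_union_right

theorem cl_subset {g : Finset U → Set U} {S M : Set U} (hM : Closed g M) (h : S ⊆ M) :
    cl g S ⊆ M := by
  refine iUnion_subset fun n => ?_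
  induction n with
  | zero => exact h
  | succ n ih =>
    rw [Function.iterate_succ_apply']
    exact union_subset ih (iUnion_subset fun s => hM s (s.2.trans ih))

theorem cl_mono (g : Finset U → Set U) {S T : Set U} (h : S ⊆ T) : cl g S ⊆ cl g T :=
  cl_subset (closed_cl g T) (h.trans (subset_cl g T))

open Cardinal in
theorem mk_cl_le {g : Finset U → Set U} (hg : ∀ s, (g s).Countable) (S : Set U)
    {κ : Cardinal} (hκ : ℵ₀ ≤ κ) (hS : #S ≤ κ) : #(cl g S) ≤ κ := by
  have hn : ∀ n : ℕ, #((step g)^[n] S : Set U) ≤ κ := by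
    intro n
    induction n with
    | zero => exact hS
    | succ n ih =>
      rw [Function.iterate_succ_apply']
      refine (mk_union_le _ _).trans (add_le_of_le hκ ih ?_)
      refine (mk_iUnion_le _).trans ?_
      have h1 : #{s : Finset U // (s : Set U) ⊆ (step g)^[n] S} ≤ κ := by
        have : #{s : Finset U // (s : Set U) ⊆ (step g)^[n] S} ≤
            #(Finset ((step g)^[n] S : Set U)) := by
          classical
          refine mk_le_of_injective (f := fun s => s.1.subtype (· ∈ (step g)^[n] S)) ?_
          rintro ⟨s, hs⟩ ⟨t, ht⟩ hst
          have := congrArg (Finset.map (Function.Embedding.subtype _)) hst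
          simp only [Finset.subtype_map] at this
          rw [Finset.filter_true_of_mem (fun x hx => hs hx),
            Finset.filter_true_of_mem (fun x hx => ht hx)] at this
          exact Subtype.ext this
        refine this.trans ?_
        rcases finite_or_infinite ((step g)^[n] S : Set U) with hf | hi
        · exact (lt_aleph0_of_finite _).le.trans hκ
        · rw [mk_finset_of_infinite]; exact ih
      refine mul_le_of_le hκ h1 ?_
      refine ciSup_le' fun s => ?_
      exact (le_aleph0_iff_set_countable.2 (hg s)).trans hκ
  have h := mk_iUnion_le_sum_mk_lift (f := fun n : ℕ => (step g)^[n] S)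
  rw [lift_uzero] at h
  refine h.trans ((sum_le_sum _ (fun _ => κ) hn).trans ?_)
  simp only [sum_const, lift_uzero, mk_nat, lift_aleph0]
  exact mul_le_of_le hκ hκ le_rfl

end ClubFilter

section Separated

open Set Filter

variable {U X : Type*} [MetricSpace X]

/-- `T` is covered by countably many uniformly separated sets. -/
def SigmaSeparated (T : Set X) : Prop :=
  ∃ (Y : ℕ → Set X) (ε : ℕ → ℝ), (∀ n, 0 < ε n) ∧
    (∀ n, ∀ y ∈ Y n, ∀ z ∈ Y n, y ≠ z → ε n ≤ dist y z) ∧ T ⊆ ⋃ n, Y n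

theorem SigmaSeparated.of_countable {T : Set X} (hT : T.Countable) : SigmaSeparated T := by
  rcases T.eq_empty_or_nonempty with rfl | hne
  · exact ⟨fun _ => ∅, fun _ => 1, by simp, by simp, by simp⟩
  · obtain ⟨e, rfl⟩ := hT.exists_eq_range hne
    refine ⟨fun n => {e n}, fun _ => 1, by simp, ?_, ?_⟩
    · rintro n y rfl z rfl h
      exact absurd rfl h
    · rintro _ ⟨n, rfl⟩
      exact mem_iUnion.2 ⟨n, rfl⟩

theorem SigmaSeparated.exists_discrete (h : SigmaSeparated (univ : Set X)) :
    ∃ Y : ℕ → Set X, (∀ n, DiscreteTopology ↥(Y n)) ∧ (⋃ n, Y n) = univ := by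
  obtain ⟨Y, ε, hε, hY, hT⟩ := h
  refine ⟨Y, fun n => ?_, univ_subset_iff.1 hT⟩
  refine DiscreteTopology.of_forall_le_dist (hε n) ?_
  intro y z hyz
  exact hY n y y.2 z z.2 (fun h => hyz (Subtype.ext h))

theorem closure_trace_subset {g : Finset U → Set U} (hg : ∀ s, (g s).Countable) {pt : X → U}
    (h : ∀ M : Set U, M.Countable → Closed g M → closure (pt ⁻¹' M) ⊆ pt ⁻¹' M)
    {M : Set U} (hM : Closed g M) : closure (pt ⁻¹' M) ⊆ pt ⁻¹' M := by
  intro y hy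
  obtain ⟨u, hu, hlim⟩ := mem_closure_iff_seq_limit.1 hy
  have hN : cl g (range (pt ∘ u)) ⊆ M := cl_subset hM (by rintro _ ⟨n, rfl⟩; exact hu n)
  refine hN (h _ ?_ (closed_cl g _) (mem_closure_iff_seq_limit.2 ⟨u, fun n => ?_, hlim⟩))
  · exact Cardinal.le_aleph0_iff_set_countable.1 (mk_cl_le hg _ le_rfl
      (Cardinal.le_aleph0_iff_set_countable.2 (countable_range _)))
  · exact subset_cl g _ ⟨n, rfl⟩

open Cardinal in
theorem sigmaSeparated_trace {g : Finset U → Set U} (hg : ∀ s, (g s).Countable) {pt : X → U}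
    (hpt : Function.Injective pt)
    (h : ∀ M : Set U, M.Countable → Closed g M → closure (pt ⁻¹' M) ⊆ pt ⁻¹' M) :
    ∀ (κ : Cardinal) (M : Set U), Closed g M → #M = κ → SigmaSeparated (pt ⁻¹' M) := by
  intro κ
  induction κ using WellFoundedLT.induction with
  | ind κ ih =>
  rintro M hM rfl
  by_cases hc : M.Countable
  · exact SigmaSeparated.of_countable (hc.preimage hpt)
  have hc' : ℵ₀ < #M := by
    rw [← not_le, le_aleph0_iff_set_countable]; exact hc
  obtain ⟨r, hwo, hr⟩ := exists_ord_eq M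
  set A : M → Set U := fun a => cl g (Subtype.val '' {b | r b a ∨ b = a}) with hA
  have hAcard : ∀ a, #(A a) < #M := by
    intro a
    have h1 : #{b | r b a} < #M := by
      have := card_typein_lt a hr
      simp only [Ordinal.card_typein] at this
      exact this
    refine (mk_cl_le hg _ (κ := max #{b | r b a} ℵ₀) (le_max_right _ _) ?_).trans_lt
      (max_lt h1 hc')
    refine mk_image_le.trans ?_
    have h2 : {b | r b a ∨ b = a} = {b | r b a} ∪ {a} := rfl
    rw [h2]
    refine (mk_union_le _ _).trans (add_le_of_le (le_max_right _ _) (le_max_left _ _) ?_)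
    rw [mk_singleton]
    exact one_le_aleph0.trans (le_max_right _ _)
  have hAmono : ∀ a b, r a b → A a ⊆ A b := by
    intro a b hab
    refine cl_mono g (image_mono ?_)
    rintro c (hc | rfl)
    · exact Or.inl (_root_.trans hc hab)
    · exact Or.inl hab
  set L : M → Set U := fun a => ⋃ b : {b // r b a}, A b with hL
  have hLclosed : ∀ a, closure (pt ⁻¹' (L a)) ⊆ pt ⁻¹' (L a) := by
    intro a
    rcases isEmpty_or_nonempty {b // r b a} with he | hne
    · have : L a = ∅ := by simp [hL]
      simp [this]
    · have hd : Directed (· ⊆ ·) fun b : {b // r b a} => A b := by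
        intro b c
        rcases trichotomous_of r b.1 c.1 with hbc | hbc | hbc
        · exact ⟨c, hAmono _ _ hbc, Subset.rfl⟩
        · exact ⟨c, (congrArg A hbc).subset, Subset.rfl⟩
        · exact ⟨b, Subset.rfl, hAmono _ _ hbc⟩
      refine closure_trace_subset hg h fun s hs => ?_
      obtain ⟨b, hb⟩ := finset_subset_of_directed hd s hs
      exact (closed_cl g _ s hb).trans (subset_iUnion (fun b : {b // r b a} => A b) b)
  choose Y ε hε hY hcov using fun a => ih _ (hAcard a) (A a) (closed_cl g _) rfl
  refine ⟨fun k => {y | ∃ a, pt y ∈ A a ∧ y ∈ Y a k.unpair.1 ∧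
      (1 / (k.unpair.2 + 1) : ℝ) ≤ ε a k.unpair.1 ∧
      ∀ z, pt z ∈ L a → (1 / (k.unpair.2 + 1) : ℝ) ≤ dist y z},
    fun k => 1 / (k.unpair.2 + 1), fun k => by positivity, ?_, ?_⟩
  · rintro k y ⟨a, hya, hyY, hεa, hya'⟩ z ⟨b, hzb, hzY, hεb, hzb'⟩ hne
    rcases trichotomous_of r a b with hab | rfl | hab
    · rw [dist_comm]
      exact hzb' y (mem_iUnion.2 ⟨⟨a, hab⟩, hya⟩)
    · exact hεa.trans (hY a _ y hyY z hzY hne)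
    · exact hya' z (mem_iUnion.2 ⟨⟨b, hab⟩, hzb⟩)
  · intro y hy
    have hne : {a | pt y ∈ A a}.Nonempty :=
      ⟨⟨pt y, hy⟩, subset_cl g _ ⟨⟨pt y, hy⟩, Or.inr rfl, rfl⟩⟩
    have wf : WellFounded r := hwo.wf
    obtain ⟨a, hya, hmin⟩ := wf.has_min _ hne
    have hyL : y ∉ pt ⁻¹' (L a) := by
      intro hyL
      obtain ⟨⟨b, hb⟩, hyb⟩ := mem_iUnion.1 hyL
      exact hmin b hyb hb
    have hyc : y ∉ closure (pt ⁻¹' (L a)) := fun hy' => hyL (hLclosed a hy')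
    rw [Metric.mem_closure_iff] at hyc
    push Not at hyc
    obtain ⟨δ, hδ, hδ'⟩ := hyc
    obtain ⟨n, hn⟩ := mem_iUnion.1 (hcov a hya)
    obtain ⟨m, hm⟩ := exists_nat_one_div_lt (lt_min hδ (hε a n))
    refine mem_iUnion.2 ⟨Nat.pair n m, a, hya, ?_⟩
    simp only [Nat.unpair_pair]
    exact ⟨hn, hm.le.trans (min_le_right _ _), fun z hz =>
      (hm.le.trans (min_le_left _ _)).trans (hδ' z hz)⟩

/-- In a metric space that is not σ-discrete, frequently many countable sets have a trace on
the space that is not closed. -/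
theorem frequently_not_closed
    (hX : ¬ ∃ Y : ℕ → Set X, (∀ n, DiscreteTopology ↥(Y n)) ∧ (⋃ n, Y n) = univ)
    {pt : X → U} (hpt : Function.Injective pt) :
    ∃ᶠ M in club U, ∃ y, y ∈ closure (pt ⁻¹' M) ∧ y ∉ pt ⁻¹' M := by
  intro hev
  obtain ⟨g, hg, hM⟩ := mem_club.1 hev
  refine hX (SigmaSeparated.exists_discrete ?_)
  have := sigmaSeparated_trace hg hpt (fun M hMc hcl y hy => ?_) _ univ
    (fun _ _ => subset_univ _) rfl
  · simpa using this
  · by_contra hy'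
    exact hM M hMc hcl ⟨y, hy, hy'⟩

end Separated

section Structures

open Set Filter

universe u

abbrev World (X : Type u) : Type u := Set X × X

/-- A family of sets of worlds, thought of as generators of an ideal to be avoided. -/
abbrev Fam (X : Type u) : Type u := Set (Set (World X))

/-- The objects over which the club filter is taken. -/
inductive Obj (X : Type u) : Type u
  | pt (x : X)
  | st (A : Set (World X))
  | bs (B : Set X)
  | fam (J : Fam X)

open Obj

def tr {X : Type u} (M : Set (Obj X)) : Set X := pt ⁻¹' M

variable {X : Type u}

theorem diag_of_injective {U V : Type*} {e : V → U} (he : Function.Injective e)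
    {p : V → Set U → Prop} (h : ∀ v, ∀ᶠ M in club U, p v M) :
    ∀ᶠ M in club U, ∀ v, e v ∈ M → p v M := by
  have := diag (p := fun u M => ∀ v, e v = u → p v M) fun u => by
    by_cases hu : ∃ v, e v = u
    · obtain ⟨v, rfl⟩ := hu
      filter_upwards [h v] with M hM w hw
      rwa [he hw]
    · exact Eventually.of_forall fun M v hv => absurd ⟨v, hv⟩ hu
  filter_upwards [this] with M hM v hv using hM _ hv v rfl

theorem pt_injective : Function.Injective (pt : X → Obj X) := fun _ _ h => by injection h
theorem st_injective : Function.Injective (st : Set (World X) → Obj X) :=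
  fun _ _ h => by injection h
theorem bs_injective : Function.Injective (bs : Set X → Obj X) := fun _ _ h => by injection h
theorem fam_injective : Function.Injective (fam : Fam X → Obj X) := fun _ _ h => by injection h

variable [MetricSpace X]

/-- `y` is a limit of the trace of `M` outside it which avoids all members of `J` coded
in `M`. -/
structure Avoid (M : Set (Obj X)) (y : X) (J : Fam X) : Prop where
  mem_closure : y ∈ closure (tr M)
  notMem : y ∉ tr M
  avoid : ∀ A ∈ J, st A ∈ M → (tr M, y) ∉ A

theorem Avoid.mono {M : Set (Obj X)} {y : X} {J J' : Fam X} (h : Avoid M y J') (hJ : J ⊆ J') :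
    Avoid M y J :=
  ⟨h.1, h.2, fun A hA => h.3 A (hJ hA)⟩

theorem Avoid.insert {M : Set (Obj X)} {y : X} {J : Fam X} {A : Set (World X)}
    (h : Avoid M y J) (hA : (tr M, y) ∉ A) : Avoid M y (insert A J) :=
  ⟨h.1, h.2, by
    rintro B (rfl | hB) hM
    · exact hA
    · exact h.3 B hB hM⟩

theorem Avoid.union {M : Set (Obj X)} {y : X} {J J' : Fam X}
    (h : Avoid M y J) (hA : ∀ A ∈ J', st A ∈ M → (tr M, y) ∉ A) : Avoid M y (J ∪ J') :=
  ⟨h.1, h.2, by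
    rintro B (hB | hB) hM
    · exact h.3 B hB hM
    · exact hA B hB hM⟩

def Good (J : Fam X) : Prop := ∃ᶠ M in club (Obj X), ∃ y, Avoid M y J

theorem Good.mono {J J' : Fam X} (h : Good J') (hJ : J ⊆ J') : Good J :=
  Frequently.mono h fun _ ⟨y, hy⟩ => ⟨y, hy.mono hJ⟩

/-- Almost surely every point avoiding `Q` satisfies `P`. -/
def Conc (Q : Fam X) (P : X → Prop) : Prop :=
  ∀ᶠ M in club (Obj X), ∀ y, Avoid M y Q → P y

theorem Conc.mono {Q Q' : Fam X} {P P' : X → Prop} (h : Conc Q P) (hQ : Q ⊆ Q')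
    (hP : ∀ y, P y → P' y) : Conc Q' P' :=
  Eventually.mono h fun _ h y hy => hP y (h y (hy.mono hQ))

theorem Conc.and {Q : Fam X} {P P' : X → Prop} (h : Conc Q P) (h' : Conc Q P') :
    Conc Q fun y => P y ∧ P' y := by
  filter_upwards [h, h'] with M h h' y hy using ⟨h y hy, h' y hy⟩

theorem conc_of_mem {Q : Fam X} {P : X → Prop} (h : {w : World X | ¬ P w.2} ∈ Q) : Conc Q P := by
  filter_upwards [eventually_mem (st {w : World X | ¬ P w.2})] with M hM y hy
  simpa using hy.avoid _ h hM

theorem conc_of_not_good {Q : Fam X} {P : X → Prop}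
    (h : ¬ Good (insert {w : World X | P w.2} Q)) : Conc Q P := by
  filter_upwards [not_frequently.1 h] with M hM y hy
  by_contra hP
  exact hM ⟨y, hy.insert hP⟩

theorem Good.exists {J : Fam X} (h : Good J) {P : Set (Obj X) → Prop}
    (hP : ∀ᶠ M in club (Obj X), P M) : ∃ M y, Avoid M y J ∧ P M := by
  obtain ⟨M, ⟨y, hy⟩, hM⟩ := (Frequently.and_eventually h hP).exists
  exact ⟨M, y, hy, hM⟩

theorem Good.exists_conc {J : Fam X} (h : Good J) {P : X → Prop} (hP : Conc J P) : ∃ y, P y := by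
  obtain ⟨M, y, hy, hM⟩ := h.exists hP
  exact ⟨y, hM y hy⟩

theorem Good.insert_of_conc {J : Fam X} {P : X → Prop} (h : Good J) (hP : Conc J P) :
    Good (insert {w : World X | ¬ P w.2} J) := by
  refine (Frequently.and_eventually h hP).mono ?_
  rintro M ⟨⟨y, hy⟩, hM⟩
  exact ⟨y, hy.insert (not_not.2 (hM y hy))⟩

variable {K : ℕ} (f : X → X → Fin K)

def S (x : X) (r : Fin K) : Set (World X) := {w | ¬ f x w.2 = r}

/-- The colours to `x` that occur among points avoiding `T`. -/
def Rs (T : Fam X) (x : X) : Set (Fin K) := {r | Good (insert (S f x r) T)}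

def Link (r : Fin K) (J T : Fam X) : Prop :=
  ∀ T', T ⊆ T' → Good T' → Conc J fun y => r ∈ Rs f T' y

structure Struct (J : Fam X) (r p : Fin K) (y : X) (Q : ℕ → Fam X) : Prop where
  subset : ∀ n, J ⊆ Q n
  good : ∀ n, Good (Q n)
  colour : ∀ n, S f y r ∈ Q n
  near : ∀ n, Conc (Q n) fun y' => dist y' y < 1 / (n + 1)
  link_r : ∀ n m, n < m → Link f r (Q m) (Q n)
  link_p : ∀ n m, n < m → Link f p (Q n) (Q m)

variable {f}

theorem Rs_mono {T T' : Fam X} (h : T ⊆ T') (x : X) : Rs f T' x ⊆ Rs f T x :=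
  fun _ hr => Good.mono hr (insert_subset_insert h)

theorem conc_of_notMem_Rs {T : Fam X} {x : X} {r : Fin K} (h : r ∉ Rs f T x) :
    Conc T fun y => ¬ f x y = r :=
  conc_of_not_good h

theorem conc_of_S_mem {T : Fam X} {x : X} {r : Fin K} (h : S f x r ∈ T) :
    Conc T fun y => f x y = r :=
  conc_of_mem h

theorem Rs_nonempty {T : Fam X} (h : Good T) (x : X) : (Rs f T x).Nonempty := by
  by_contra hne
  have : ∀ᶠ M in club (Obj X), ∀ r, ∀ y, Avoid M y T → ¬ f x y = r :=
    eventually_all.2 fun r => conc_of_notMem_Rs (fun hr => hne ⟨r, hr⟩)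
  obtain ⟨M, y, hy, hM⟩ := h.exists this
  exact hM _ y hy rfl

theorem Link.mono {r : Fin K} {J J' T T' : Fam X} (h : Link f r J T) (hJ : J ⊆ J')
    (hT : T ⊆ T') : Link f r J' T' :=
  fun T'' hT'' hG => (h T'' (hT.trans hT'') hG).mono hJ fun _ => id

theorem Link.conc {r : Fin K} {J T : Fam X} (h : Link f r J T) (hT : Good T) :
    Conc J fun y => r ∈ Rs f T y :=
  h T Subset.rfl hT

variable (f) in
def alt (k : ℕ) (T : Fam X) : Set (World X) := {w | ¬ k ≤ (Rs f T w.2).ncard}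

variable (f) in
def altFam (J : Fam X) (k : ℕ) : Fam X := {A | ∃ T, J ⊆ T ∧ Good T ∧ A = alt f k T}

variable (f) in
def gs (p : Fin K) (B : Set X) : Set (World X) := {w | ∀ x ∈ B, x ∈ w.1 → f x w.2 ≠ p}

variable (f) in
def gsFam (Q : Fam X) (B : Set X) (p : Fin K) : Fam X :=
  {A | ∃ B' ⊆ B, Good (insert {w | ¬ w.2 ∈ B'} Q) ∧ A = gs f p B'}

variable (f) in
/-- Closure properties of `M` with respect to the constructions used below. -/
structure Elem (M : Set (Obj X)) : Prop where
  good : ∀ J, fam J ∈ M → ∀ y, Avoid M y J → Good J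
  insert : ∀ A J, st A ∈ M → fam J ∈ M → fam (insert A J) ∈ M
  ball : ∀ x, pt x ∈ M → ∀ n : ℕ, st {w | ¬ dist w.2 x < 1 / (2 * (n + 1))} ∈ M
  alt_closed : ∀ J, fam J ∈ M → ∀ k, fam (J ∪ altFam f J k) ∈ M
  alt_wit : ∀ J, fam J ∈ M → ∀ A, st A ∈ M → ∀ k, A ∈ altFam f J k →
    ∃ T, fam T ∈ M ∧ J ⊆ T ∧ Good T ∧ A = alt f k T
  sub : ∀ T, fam T ∈ M → ∀ R, st {w | ¬ Rs f T w.2 ⊆ R} ∈ M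
  compl : ∀ B, bs B ∈ M → st {w | ¬ w.2 ∈ B} ∈ M
  point : ∀ B, bs B ∈ M → B.Nonempty → ∃ x ∈ B, pt x ∈ M
  univ : bs univ ∈ M
  gs_closed : ∀ J, fam J ∈ M → ∀ Q, fam Q ∈ M → ∀ B, bs B ∈ M → ∀ p,
    fam (J ∪ gsFam f Q B p) ∈ M
  gs_wit : ∀ A, st A ∈ M → ∀ Q, fam Q ∈ M → ∀ B, bs B ∈ M → ∀ p,
    A ∈ gsFam f Q B p →
    ∃ B' ⊆ B, bs B' ∈ M ∧ Good (Insert.insert {w | ¬ w.2 ∈ B'} Q) ∧ A = gs f p B'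

variable (f) in
theorem eventually_elem : ∀ᶠ M in club (Obj X), Elem f M := by
  have good : ∀ᶠ M in club (Obj X), ∀ J, fam J ∈ M → ∀ y, Avoid M y J → Good J := by
    refine diag_of_injective fam_injective fun J => ?_
    by_cases h : Good J
    · exact Eventually.of_forall fun _ _ _ => h
    · filter_upwards [not_frequently.1 h] with M hM y hy using absurd ⟨y, hy⟩ hM
  have hins : ∀ᶠ M in club (Obj X), ∀ A : Set (World X), st A ∈ M → ∀ J, fam J ∈ M →
      fam (insert A J) ∈ M :=
    diag_of_injective st_injective fun A => diag_of_injective fam_injective fun J =>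
      eventually_mem _
  have ball : ∀ᶠ M in club (Obj X), ∀ x : X, pt x ∈ M → ∀ n : ℕ,
      st {w | ¬ dist w.2 x < 1 / (2 * (n + 1))} ∈ M :=
    diag_of_injective pt_injective fun x => eventually_countable_forall.2 fun n =>
      eventually_mem _
  have alt1 : ∀ᶠ M in club (Obj X), ∀ J, fam J ∈ M → ∀ k,
      fam (J ∪ altFam f J k) ∈ M :=
    diag_of_injective fam_injective fun J => eventually_countable_forall.2 fun n =>
      eventually_mem _
  have alt_wit : ∀ᶠ M in club (Obj X), ∀ J, fam J ∈ M → ∀ A, st A ∈ M → ∀ k,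
      A ∈ altFam f J k → ∃ T, fam T ∈ M ∧ J ⊆ T ∧ Good T ∧ A = alt f k T := by
    refine diag_of_injective fam_injective fun J => diag_of_injective st_injective fun A =>
      eventually_countable_forall.2 fun k => ?_
    by_cases h : A ∈ altFam f J k
    · obtain ⟨T, hT⟩ := h
      filter_upwards [eventually_mem (fam T)] with M hM _ using ⟨T, hM, hT⟩
    · exact Eventually.of_forall fun _ h' => absurd h' h
  have sub : ∀ᶠ M in club (Obj X), ∀ T, fam T ∈ M → ∀ R,
      st {w | ¬ Rs f T w.2 ⊆ R} ∈ M :=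
    diag_of_injective fam_injective fun J => eventually_countable_forall.2 fun n =>
      eventually_mem _
  have compl : ∀ᶠ M in club (Obj X), ∀ B : Set X, bs B ∈ M →
      st {w : World X | ¬ w.2 ∈ B} ∈ M :=
    diag_of_injective bs_injective fun B => eventually_mem _
  have point : ∀ᶠ M in club (Obj X), ∀ B : Set X, bs B ∈ M → B.Nonempty →
      ∃ x ∈ B, pt x ∈ M := by
    refine diag_of_injective bs_injective fun B => ?_
    by_cases h : B.Nonempty
    · obtain ⟨x, hx⟩ := h
      filter_upwards [eventually_mem (pt x)] with M hM _ using ⟨x, hx, hM⟩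
    · exact Eventually.of_forall fun _ h' => absurd h' h
  have hgs : ∀ᶠ M in club (Obj X), ∀ J, fam J ∈ M → ∀ Q, fam Q ∈ M → ∀ B, bs B ∈ M → ∀ p,
      fam (J ∪ gsFam f Q B p) ∈ M :=
    diag_of_injective fam_injective fun J => diag_of_injective fam_injective fun Q =>
      diag_of_injective bs_injective fun B => eventually_countable_forall.2 fun p =>
        eventually_mem _
  have gs_wit : ∀ᶠ M in club (Obj X), ∀ A, st A ∈ M → ∀ Q, fam Q ∈ M → ∀ B, bs B ∈ M → ∀ p,
      A ∈ gsFam f Q B p →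
      ∃ B' ⊆ B, bs B' ∈ M ∧ Good (insert {w | ¬ w.2 ∈ B'} Q) ∧ A = gs f p B' := by
    refine diag_of_injective st_injective fun A => diag_of_injective fam_injective fun Q =>
      diag_of_injective bs_injective fun B => eventually_countable_forall.2 fun p => ?_
    by_cases h : A ∈ gsFam f Q B p
    · obtain ⟨B', hB, hT⟩ := h
      filter_upwards [eventually_mem (bs B')] with M hM _ using ⟨B', hB, hM, hT⟩
    · exact Eventually.of_forall fun _ h' => absurd h' h
  filter_upwards [good, hins, ball, alt1, alt_wit, sub, compl, point, eventually_mem (bs univ),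
    hgs, gs_wit] with M h1 h2 h3 h4 h5 h6 h7 h8 h9 h10 h11
  exact ⟨h1, fun A J hA hJ => h2 A hA J hJ, h3, h4, h5, h6, h7, h8, h9, h10, h11⟩

end Structures

section Existence

open Set Filter Obj

universe u
variable {X : Type u} [MetricSpace X] {K : ℕ} {f : X → X → Fin K}

/-- `J` is coded in `M` and avoided by `y`. -/
def Gen (M : Set (Obj X)) (y : X) (J : Fam X) : Prop := fam J ∈ M ∧ Avoid M y J

theorem Gen.insert {M : Set (Obj X)} {y : X} {J : Fam X} {A : Set (World X)} (hJ : Gen M y J)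
    (hM : Elem f M) (hA : st A ∈ M) (hy : (tr M, y) ∉ A) : Gen M y (insert A J) :=
  ⟨hM.insert A J hA hJ.1, hJ.2.insert hy⟩

theorem exists_r_step {M : Set (Obj X)} (hM : Elem f M) {y : X} {J : Fam X} (hJ : Gen M y J) :
    ∃ T J' : Fam X, J ⊆ T ∧ fam T ∈ M ∧ Good T ∧ J ⊆ J' ∧ Gen M y J' ∧
      ∀ r ∈ Rs f T y, Link f r J' T ∧
        ∀ T', T ⊆ T' → Good T' → fam T' ∈ M → r ∈ Rs f T' y := by
  classical
  let P : ℕ → Prop := fun k => ∃ J₁, J ⊆ J₁ ∧ Gen M y J₁ ∧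
    ∀ T, fam T ∈ M → J₁ ⊆ T → Good T → k ≤ (Rs f T y).ncard
  have hP0 : P 0 := ⟨J, Subset.rfl, hJ, fun _ _ _ _ => Nat.zero_le _⟩
  have hPK : ∀ k, P k → k ≤ K := by
    rintro k ⟨J₁, -, hJ₁, h⟩
    refine (h J₁ hJ₁.1 Subset.rfl (hM.good _ hJ₁.1 y hJ₁.2)).trans ?_
    exact (ncard_le_card _).trans (by simp)
  obtain ⟨k, hk, hk'⟩ : ∃ k, P k ∧ ¬ P (k + 1) := by
    by_contra! hcon
    have : ∀ k, P k := fun k => Nat.rec hP0 (fun k ih => hcon k ih) k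
    exact absurd (hPK _ (this (K + 1))) (by omega)
  obtain ⟨J₁, hJJ₁, hJ₁, hk₁⟩ := hk
  set J₂ := J₁ ∪ altFam f J₁ k with hJ₂def
  have hJ₂ : Gen M y J₂ := by
    refine ⟨hM.alt_closed _ hJ₁.1 k, hJ₁.2.union fun A hA hAM => ?_⟩
    obtain ⟨T, hTM, hT, hG, rfl⟩ := hM.alt_wit _ hJ₁.1 A hAM k hA
    exact not_not.2 (hk₁ T hTM hT hG)
  have : ∃ T, fam T ∈ M ∧ J₂ ⊆ T ∧ Good T ∧ (Rs f T y).ncard ≤ k := by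
    by_contra! hcon
    exact hk' ⟨J₂, hJJ₁.trans subset_union_left, hJ₂, fun T h1 h2 h3 => hcon T h1 h2 h3⟩
  obtain ⟨T, hTM, hJT, hGT, hTk⟩ := this
  have hJ₁T : J₁ ⊆ T := subset_union_left.trans hJT
  refine ⟨T, insert {w | ¬ Rs f T w.2 ⊆ Rs f T y} J₂, hJJ₁.trans hJ₁T, hTM, hGT,
    (hJJ₁.trans subset_union_left).trans (subset_insert _ _),
    hJ₂.insert hM (hM.sub T hTM _) (not_not.2 Subset.rfl), fun r hr => ⟨?_, ?_⟩⟩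
  · intro T' hT' hG'
    have h1 : Conc (insert {w : World X | ¬ Rs f T w.2 ⊆ Rs f T y} J₂)
        fun y' => Rs f T y' ⊆ Rs f T y := conc_of_mem (mem_insert _ _)
    have h2 : Conc (insert {w : World X | ¬ Rs f T w.2 ⊆ Rs f T y} J₂)
        fun y' => k ≤ (Rs f T' y').ncard :=
      conc_of_mem (mem_insert_of_mem _ (Or.inr ⟨T', hJ₁T.trans hT', hG', rfl⟩))
    refine (h1.and h2).mono Subset.rfl ?_
    rintro y' ⟨h1, h2⟩
    rw [eq_of_subset_of_ncard_le ((Rs_mono hT' y').trans h1) (hTk.trans h2)]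
    exact hr
  · intro T' hT' hG' hTM'
    rw [eq_of_subset_of_ncard_le (Rs_mono hT' y) (hTk.trans (hk₁ T' hTM' (hJ₁T.trans hT') hG'))]
    exact hr

theorem exists_p_step {M : Set (Obj X)} (hM : Elem f M) {y : X} {J Q : Fam X} (hJ : Gen M y J)
    (hQM : fam Q ∈ M) (hQ : Good Q) :
    ∃ (p : Fin K) (Q' J' : Fam X), Q ⊆ Q' ∧ fam Q' ∈ M ∧ Good Q' ∧ J ⊆ J' ∧ Gen M y J' ∧
      Link f p Q' J' := by
  classical
  let H : ℕ → Prop := fun n => ∃ (B : Set X) (P : Set (Fin K)), bs B ∈ M ∧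
    Good (insert {w | ¬ w.2 ∈ B} Q) ∧ (∀ x ∈ B, pt x ∈ M → f x y ∈ P) ∧ P.ncard = n
  have hex : ∃ n, H n := ⟨_, univ, univ, hM.univ,
    hQ.insert_of_conc (P := fun y => y ∈ univ)
      (Eventually.of_forall fun _ _ _ => mem_univ _), fun _ _ _ => mem_univ _, rfl⟩
  obtain ⟨B, P, hBM, hGB, hBP, hn⟩ := Nat.find_spec hex
  have hmin : ∀ (B' : Set X) (P' : Set (Fin K)), bs B' ∈ M → Good (insert {w | ¬ w.2 ∈ B'} Q) →
      (∀ x ∈ B', pt x ∈ M → f x y ∈ P') → P.ncard ≤ P'.ncard := by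
    intro B' P' h1 h2 h3
    rw [hn]
    exact Nat.find_min' hex ⟨B', P', h1, h2, h3, rfl⟩
  have hBne : B.Nonempty :=
    hGB.exists_conc (conc_of_mem (P := fun y => y ∈ B) (mem_insert _ _))
  obtain ⟨x₀, hx₀, hx₀M⟩ := hM.point B hBM hBne
  have hp := hBP x₀ hx₀ hx₀M
  set p := f x₀ y
  set Q' : Fam X := insert {w | ¬ w.2 ∈ B} Q with hQ'
  have hQ'M : fam Q' ∈ M := hM.insert _ _ (hM.compl B hBM) hQM
  refine ⟨p, Q', J ∪ gsFam f Q' B p, subset_insert _ _, hQ'M, hGB, subset_union_left,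
    ⟨hM.gs_closed _ hJ.1 _ hQ'M _ hBM p, hJ.2.union fun A hA hAM => ?_⟩, ?_⟩
  · obtain ⟨B', hB', hBM', hG', rfl⟩ := hM.gs_wit A hAM Q' hQ'M B hBM p hA
    intro hmem
    have := hmin B' (P \ {p}) hBM' (hG'.mono (insert_subset_insert (subset_insert _ _)))
      fun x hx hxM => ⟨hBP x (hB' hx) hxM, hmem x hx hxM⟩
    have h2 := ncard_sdiff_singleton_lt_of_mem hp (toFinite P)
    omega
  · intro T' hT' hGT'
    by_contra hcon
    have hG : Good (insert {w : World X | p ∈ Rs f T' w.2} Q') := by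
      by_contra h
      exact hcon (conc_of_not_good h)
    set B' : Set X := {x ∈ B | p ∉ Rs f T' x} with hB'
    have hGB' : Good (insert {w : World X | ¬ w.2 ∈ B'} Q') := by
      refine (hG.insert_of_conc (P := fun y => y ∈ B') ?_).mono
        (insert_subset_insert (subset_insert _ _))
      have h1 : Conc (insert {w : World X | p ∈ Rs f T' w.2} Q') fun y => y ∈ B :=
        conc_of_mem (mem_insert_of_mem _ (mem_insert _ _))
      have h2 : Conc (insert {w : World X | p ∈ Rs f T' w.2} Q') fun y => p ∉ Rs f T' y :=
        conc_of_mem (by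
          convert mem_insert _ _ using 2
          ext w
          simp)
      exact h1.and h2
    have hmem : gs f p B' ∈ T' := hT' (Or.inr ⟨B', fun x hx => hx.1, hGB', rfl⟩)
    have hdiag : ∀ᶠ N in club (Obj X), ∀ x, pt x ∈ N → x ∈ B' → ∀ y', Avoid N y' T' →
        f x y' ≠ p := by
      refine diag_of_injective pt_injective fun x => ?_
      by_cases hx : x ∈ B'
      · filter_upwards [conc_of_notMem_Rs hx.2] with N hN _ using hN
      · exact Eventually.of_forall fun N h => absurd h hx
    obtain ⟨N, y', hy', hN1, hN2⟩ := hGT'.exists (hdiag.and (eventually_mem (st (gs f p B'))))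
    exact hy'.avoid _ hmem hN2 fun x hx hxN => hN1 x hxN hx y' hy'

theorem exists_step {M : Set (Obj X)} (hM : Elem f M) {y : X} {J : Fam X} (hJ : Gen M y J)
    (n : ℕ) :
    ∃ (r p : Fin K) (Q J' : Fam X), J ⊆ J' ∧ Gen M y J' ∧ J ⊆ Q ∧ r ∈ Rs f Q y ∧
      Conc Q (fun y' => dist y' y < 1 / (n + 1)) ∧ Link f r J' Q ∧ Link f p Q J' := by
  have hpos : (0 : ℝ) < 1 / (2 * (n + 1)) := by positivity
  obtain ⟨x, hxM, hxy⟩ := Metric.mem_closure_iff.1 hJ.2.mem_closure _ hpos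
  have hJ₁ : Gen M y (insert {w | ¬ dist w.2 x < 1 / (2 * (n + 1))} J) :=
    hJ.insert hM (hM.ball x hxM n) (not_not.2 hxy)
  obtain ⟨T, J₂, hJT, hTM, hT, hJ₂, hGen₂, hR⟩ := exists_r_step hM hJ₁
  obtain ⟨p, Q, J₃, hTQ, hQM, hQ, hJ₃, hGen₃, hp⟩ := exists_p_step hM hGen₂ hTM hT
  obtain ⟨r, hr⟩ := Rs_nonempty (f := f) hT y
  obtain ⟨hr1, hr2⟩ := hR r hr
  refine ⟨r, p, Q, J₃, (subset_insert _ _).trans (hJ₂.trans hJ₃), hGen₃,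
    (subset_insert _ _).trans (hJT.trans hTQ), hr2 Q hTQ hQ hQM, ?_, hr1.mono hJ₃ hTQ, hp⟩
  have : Conc Q fun y' => dist y' x < 1 / (2 * (n + 1)) :=
    conc_of_mem (hTQ (hJT (mem_insert _ _)))
  refine this.mono Subset.rfl fun y' hy' => ?_
  calc dist y' y ≤ dist y' x + dist y x := dist_triangle_right _ _ _
    _ < 1 / (2 * (n + 1)) + 1 / (2 * (n + 1)) := add_lt_add hy' hxy
    _ = 1 / (n + 1) := by field_simp; norm_num

theorem exists_struct {M : Set (Obj X)} (hM : Elem f M) {y : X} {J : Fam X} (hJ : Gen M y J) :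
    ∃ r p Q, Struct f J r p y Q := by
  choose r p Q J' h1 h2 h3 h4 h5 h6 h7 using
    fun (s : {J // Gen M y J}) n => exists_step hM s.2 n
  let s : ℕ → {J // Gen M y J} := fun n =>
    Nat.rec ⟨J, hJ⟩ (fun n t => ⟨J' t n, h2 t n⟩) n
  have hs : ∀ n, (s (n + 1)).1 = J' (s n) n := fun n => rfl
  have hmono : Monotone fun n => (s n).1 := monotone_nat_of_le_succ fun n => by
    rw [hs]; exact h1 _ _
  obtain ⟨⟨r₀, p₀⟩, hinf⟩ :=
    Finite.exists_infinite_fiber fun n => ((r (s n) n, p (s n) n) : Fin K × Fin K)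
  rw [infinite_coe_iff] at hinf
  obtain ⟨φ, hφ, hφ'⟩ := Nat.exists_strictMono_subsequence
    (P := fun n => (r (s n) n, p (s n) n) = (r₀, p₀)) (fun N => by
      obtain ⟨n, hn, hN⟩ := hinf.exists_gt N
      exact ⟨n, hN, hn⟩)
  have hr : ∀ n, r (s (φ n)) (φ n) = r₀ := fun n => (Prod.ext_iff.1 (hφ' n)).1
  have hp : ∀ n, p (s (φ n)) (φ n) = p₀ := fun n => (Prod.ext_iff.1 (hφ' n)).2
  have hsub : ∀ n m, n < m → J' (s (φ n)) (φ n) ⊆ Q (s (φ m)) (φ m) := fun n m hnm => by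
    rw [← hs]
    exact (hmono (Nat.succ_le_of_lt (hφ hnm))).trans (h3 _ _)
  refine ⟨r₀, p₀, fun n => insert (S f y r₀) (Q (s (φ n)) (φ n)), ?_, ?_, ?_, ?_, ?_, ?_⟩
  · intro n
    exact ((hmono (Nat.zero_le (φ n))).trans (h3 _ _)).trans (subset_insert _ _)
  · intro n
    have := h4 (s (φ n)) (φ n)
    rwa [hr] at this
  · exact fun n => mem_insert _ _
  · intro n
    refine (h5 (s (φ n)) (φ n)).mono (subset_insert _ _) fun y' hy' => hy'.trans_le ?_
    have : (n : ℝ) ≤ φ n := by exact_mod_cast hφ.id_le n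
    gcongr
  · intro n m hnm
    have := h6 (s (φ n)) (φ n)
    rw [hr] at this
    exact this.mono ((hsub n m hnm).trans (subset_insert _ _)) (subset_insert _ _)
  · intro n m hnm
    have := h7 (s (φ n)) (φ n)
    rw [hp] at this
    exact this.mono (subset_insert _ _) ((hsub n m hnm).trans (subset_insert _ _))

variable (f) in
theorem eventually_exists_struct (J : Fam X) :
    ∀ᶠ M in club (Obj X), ∀ y, Avoid M y J → ∃ r p Q, Struct f J r p y Q := by
  filter_upwards [eventually_elem f, eventually_mem (fam J)] with M hM hJ y hy
  exact exists_struct hM ⟨hJ, hy⟩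

end Existence

section Construction

open Set Filter Obj

universe u
variable {X : Type u} [MetricSpace X] {K : ℕ} {f : X → X → Fin K}

variable (f) in
/-- Frequently some point avoiding `J` carries a structure with colours `r` and `p`. -/
def Typical (J : Fam X) (r p : Fin K) : Prop :=
  ∃ᶠ M in club (Obj X), ∃ y, Avoid M y J ∧ ∃ Q, Struct f J r p y Q

theorem Struct.mono {J J' : Fam X} {r p : Fin K} {y : X} {Q : ℕ → Fam X}
    (h : Struct f J' r p y Q) (hJ : J ⊆ J') : Struct f J r p y Q :=
  { h with subset := fun n => hJ.trans (h.subset n) }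

theorem Typical.mono {J J' : Fam X} {r p : Fin K} (h : Typical f J' r p) (hJ : J ⊆ J') :
    Typical f J r p :=
  Frequently.mono h fun _ ⟨y, hy, Q, hQ⟩ => ⟨y, hy.mono hJ, Q, hQ.mono hJ⟩

variable (f) in
theorem exists_uniform_type (h : Good (∅ : Fam X)) :
    ∃ (J₀ : Fam X) (r p : Fin K), Good J₀ ∧ ∀ J, J₀ ⊆ J → Good J → Typical f J r p := by
  classical
  by_contra! hcon
  have key : ∀ s : Finset (Fin K × Fin K), ∃ J : Fam X, Good J ∧
      ∀ τ ∈ s, ¬ Typical f J τ.1 τ.2 := by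
    intro s
    induction s using Finset.induction_on with
    | empty => exact ⟨∅, h, by simp⟩
    | insert τ s _ ih =>
      obtain ⟨J, hJ, hs⟩ := ih
      obtain ⟨J', hJJ', hJ', hτ⟩ := hcon J τ.1 τ.2 hJ
      refine ⟨J', hJ', fun σ hσ => ?_⟩
      rcases Finset.mem_insert.1 hσ with rfl | hσ
      · exact hτ
      · exact fun h' => hs σ hσ (h'.mono hJJ')
  obtain ⟨J, hJ, hall⟩ := key Finset.univ
  have hev : ∀ᶠ M in club (Obj X), ∀ τ : Fin K × Fin K,
      ¬ ∃ y, Avoid M y J ∧ ∃ Q, Struct f J τ.1 τ.2 y Q :=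
    eventually_all.2 fun τ => not_frequently.1 (hall τ (Finset.mem_univ _))
  obtain ⟨M, y, hy, hM, hM'⟩ := hJ.exists (hev.and (eventually_exists_struct f J))
  obtain ⟨r, p, Q, hQ⟩ := hM' y hy
  exact hM (r, p) ⟨y, hy, Q, hQ⟩

variable (f) in
def Linked (C : Set (Fin K)) (Q Q' : Fam X) : Prop := ∃ c ∈ C, Link f c Q Q'

theorem Linked.mono {C : Set (Fin K)} {J J' T T' : Fam X} (h : Linked f C J T) (hJ : J ⊆ J')
    (hT : T ⊆ T') : Linked f C J' T' :=
  let ⟨c, hc, h⟩ := h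
  ⟨c, hc, h.mono hJ hT⟩

variable (f) in
/-- The invariant of the construction after the points `x 0, …, x t` have been chosen. -/
structure Inv (C : Set (Fin K)) (J₀ : Fam X) (t : ℕ) (x : ℕ → X) (Q : ℕ → ℕ → Fam X) : Prop where
  good : ∀ i ≤ t, ∀ k, Good (Q i k)
  subset : ∀ i ≤ t, ∀ k, J₀ ⊆ Q i k
  near : ∀ i ≤ t, ∀ k, Conc (Q i k) fun y => dist y (x i) < 1 / (k + 1)
  conc : ∀ i ≤ t, ∀ k, ∀ j ≤ t, Conc (Q i k) fun y => f (x j) y ∈ C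
  linked : ∀ i ≤ t, ∀ k, ∀ j ≤ t, ∀ l, (i, k) ≠ (j, l) → Linked f C (Q i k) (Q j l)
  colour : ∀ i ≤ t, ∀ j ≤ t, i ≠ j → f (x i) (x j) ∈ C
  ne : ∀ i ≤ t, ∀ j ≤ t, i ≠ j → x i ≠ x j

theorem Struct.linked {J : Fam X} {r p : Fin K} {y : X} {Q : ℕ → Fam X}
    (h : Struct f J r p y Q) {l m : ℕ} (hlm : l ≠ m) : Linked f {r, p} (Q l) (Q m) := by
  rcases lt_or_gt_of_ne hlm with h' | h'
  · exact ⟨p, by simp, h.link_p _ _ h'⟩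
  · exact ⟨r, by simp, h.link_r _ _ h'⟩

theorem Struct.conc_self {J : Fam X} {r p : Fin K} {y : X} {Q : ℕ → Fam X}
    (h : Struct f J r p y Q) (n : ℕ) : Conc (Q n) fun z => f y z ∈ ({r, p} : Set (Fin K)) :=
  (conc_of_S_mem (h.colour n)).mono Subset.rfl fun z hz => by simp [hz]

theorem Inv.init {J : Fam X} {r p : Fin K} {y : X} {Q : ℕ → Fam X} (h : Struct f J r p y Q) :
    Inv f {r, p} J 0 (fun _ => y) fun _ => Q where
  good _ _ := h.good
  subset _ _ := h.subset
  near _ _ := h.near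
  conc _ _ k _ _ := h.conc_self k
  linked i hi k j hj l hne := by
    obtain rfl := Nat.le_zero.1 hi
    obtain rfl := Nat.le_zero.1 hj
    exact h.linked fun hkl => hne (by rw [hkl])
  colour i hi j hj hne := absurd ((Nat.le_zero.1 hi).trans (Nat.le_zero.1 hj).symm) hne
  ne i hi j hj hne := absurd ((Nat.le_zero.1 hi).trans (Nat.le_zero.1 hj).symm) hne

theorem Inv.step (hf : ∀ x y, f x y = f y x) {J₀ : Fam X} {r p : Fin K}
    (hJ₀ : ∀ J, J₀ ⊆ J → Good J → Typical f J r p) {t : ℕ} {x : ℕ → X} {Q : ℕ → ℕ → Fam X}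
    (h : Inv f {r, p} J₀ t x Q) {i : ℕ} (hi : i ≤ t) (k : ℕ) :
    ∃ x' Q', Inv f {r, p} J₀ (t + 1) x' Q' ∧ (∀ j ≤ t, x' j = x j) ∧
      dist (x' (t + 1)) (x i) < 1 / (k + 1) := by
  classical
  set C : Set (Fin K) := {r, p} with hC
  have E2 : ∀ᶠ M in club (Obj X), ∀ j, j ≤ t → ∀ y, Avoid M y (Q i k) → f (x j) y ∈ C :=
    eventually_countable_forall.2 fun j => eventually_imp_distrib_left.2 fun hj =>
      h.conc i hi k j hj
  have E3 : ∀ᶠ M in club (Obj X), ∀ j, pt (x j) ∈ M :=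
    eventually_countable_forall.2 fun j => eventually_mem _
  have E4 : ∀ᶠ M in club (Obj X), ∀ j l, (j ≤ t ∧ (i, k) ≠ (j, l)) →
      ∀ y, Avoid M y (Q i k) → ∃ c ∈ C, c ∈ Rs f (Q j l) y :=
    eventually_countable_forall.2 fun j => eventually_countable_forall.2 fun l =>
      eventually_imp_distrib_left.2 fun ⟨hj, hne⟩ => by
        obtain ⟨c, hc, hlink⟩ := h.linked i hi k j hj l hne
        exact (hlink.conc (h.good j hj l)).mono Subset.rfl fun y hy => ⟨c, hc, hy⟩
  obtain ⟨M, ⟨y, hy, R, hR⟩, e1, e2, e3, e4⟩ := (Frequently.and_eventually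
    (hJ₀ _ (h.subset i hi k) (h.good i hi k))
    (Eventually.and (h.near i hi k) (E2.and (E3.and E4)))).exists
  have hyx : ∀ j, y ≠ x j := fun j hj => hy.notMem (by rw [hj]; exact e3 j)
  have hyC : ∀ j ≤ t, f (x j) y ∈ C := fun j hj => e2 j hj y hy
  have e4' : ∀ j l, ∃ c, (j ≤ t ∧ (i, k) ≠ (j, l)) → c ∈ C ∧ c ∈ Rs f (Q j l) y := by
    intro j l
    by_cases hjl : j ≤ t ∧ (i, k) ≠ (j, l)
    · obtain ⟨c, hc⟩ := e4 j l hjl y hy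
      exact ⟨c, fun _ => hc⟩
    · exact ⟨r, fun h => absurd h hjl⟩
  choose c hc using e4'
  let e : ℕ → ℕ → ℕ := fun j l => if j = i then l + k + 1 else l
  have he : ∀ j l, l ≤ e j l := by
    intro j l
    simp only [e]
    split_ifs <;> omega
  have he' : ∀ j l, (i, k) ≠ (j, e j l) := by
    rintro j l hjl
    obtain ⟨rfl, hk⟩ := Prod.ext_iff.1 hjl
    simp [e] at hk
    omega
  have he'' : ∀ j l m, e j l = e j m → l = m := by
    intro j l m
    simp only [e]
    split_ifs <;> omega
  let x' : ℕ → X := Function.update x (t + 1) y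
  let B : ℕ → ℕ → Fam X := fun j l => insert (S f y (c j (e j l))) (Q j (e j l))
  let Q' : ℕ → ℕ → Fam X := Function.update B (t + 1) R
  have hx' : ∀ j ≤ t, x' j = x j := fun j hj => Function.update_of_ne (by omega) _ _
  have hxt : x' (t + 1) = y := Function.update_self _ _ _
  have hQ' : ∀ j ≤ t, Q' j = B j := fun j hj => Function.update_of_ne (by omega) _ _
  have hQt : Q' (t + 1) = R := Function.update_self _ _ _
  have hQB : ∀ j l, Q j (e j l) ⊆ B j l := fun j l => subset_insert _ _
  refine ⟨x', Q', ⟨?_, ?_, ?_, ?_, ?_, ?_, ?_⟩, hx', by rw [hxt]; exact e1 y hy⟩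
  · intro j hj l
    rcases Nat.le_succ_iff.1 hj with hj | rfl
    · rw [hQ' j hj]
      exact (hc j _ ⟨hj, he' j l⟩).2
    · rw [hQt]
      exact hR.good l
  · intro j hj l
    rcases Nat.le_succ_iff.1 hj with hj | rfl
    · rw [hQ' j hj]
      exact (h.subset j hj _).trans (hQB j l)
    · rw [hQt]
      exact (h.subset i hi k).trans (hR.subset l)
  · intro j hj l
    rcases Nat.le_succ_iff.1 hj with hj | rfl
    · rw [hQ' j hj, hx' j hj]
      refine (h.near j hj _).mono (hQB j l) fun z hz => hz.trans_le ?_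
      have : (l : ℝ) ≤ e j l := by exact_mod_cast he j l
      gcongr
    · rw [hQt, hxt]
      exact hR.near l
  · intro j hj l j' hj'
    rcases Nat.le_succ_iff.1 hj with hj | rfl <;> rcases Nat.le_succ_iff.1 hj' with hj' | rfl
    · rw [hQ' j hj, hx' j' hj']
      exact (h.conc j hj _ j' hj').mono (hQB j l) fun _ => id
    · rw [hQ' j hj, hxt]
      exact (conc_of_S_mem (mem_insert _ _)).mono Subset.rfl fun z hz => by
        rw [hz]
        exact (hc j _ ⟨hj, he' j l⟩).1
    · rw [hQt, hx' j' hj']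
      exact (h.conc i hi k j' hj').mono (hR.subset l) fun _ => id
    · rw [hQt, hxt]
      exact hR.conc_self l
  · intro j hj l j' hj' l' hne
    rcases Nat.le_succ_iff.1 hj with hj | rfl <;> rcases Nat.le_succ_iff.1 hj' with hj' | rfl
    · rw [hQ' j hj, hQ' j' hj']
      refine (h.linked j hj (e j l) j' hj' (e j' l') fun heq => hne ?_).mono (hQB _ _) (hQB _ _)
      obtain ⟨rfl, hl⟩ := Prod.ext_iff.1 heq
      rw [he'' _ _ _ hl]
    · rw [hQ' j hj, hQt]
      exact (h.linked j hj _ i hi k (he' j l).symm).mono (hQB _ _) (hR.subset _)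
    · rw [hQ' j' hj', hQt]
      exact (h.linked i hi k j' hj' _ (he' j' l')).mono (hR.subset _) (hQB _ _)
    · rw [hQt]
      exact hR.linked fun hll => hne (by rw [hll])
  · intro j hj j' hj' hne
    rcases Nat.le_succ_iff.1 hj with hj | rfl <;> rcases Nat.le_succ_iff.1 hj' with hj' | rfl
    · rw [hx' j hj, hx' j' hj']
      exact h.colour j hj j' hj' hne
    · rw [hx' j hj, hxt]
      exact hyC j hj
    · rw [hx' j' hj', hxt, hf]
      exact hyC j' hj'
    · exact absurd rfl hne
  · intro j hj j' hj' hne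
    rcases Nat.le_succ_iff.1 hj with hj | rfl <;> rcases Nat.le_succ_iff.1 hj' with hj' | rfl
    · rw [hx' j hj, hx' j' hj']
      exact h.ne j hj j' hj' hne
    · rw [hx' j hj, hxt]
      exact (hyx j).symm
    · rw [hx' j' hj', hxt]
      exact hyx j'
    · exact absurd rfl hne

theorem exists_dense_in_itself_seq (hf : ∀ x y, f x y = f y x) (hG : Good (∅ : Fam X)) :
    ∃ (r p : Fin K) (z : ℕ → X), Function.Injective z ∧
      (∀ i j, i ≠ j → f (z i) (z j) ∈ ({r, p} : Set (Fin K))) ∧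
      ∀ i, ∀ ε > 0, ∃ j, j ≠ i ∧ dist (z j) (z i) < ε := by
  obtain ⟨J₀, r, p, hJ₀, htyp⟩ := exists_uniform_type f hG
  obtain ⟨M, y, -, R, hR⟩ := (htyp J₀ Subset.rfl hJ₀).exists
  let St : ℕ → Type u := fun t => {s : (ℕ → X) × (ℕ → ℕ → Fam X) // Inv f {r, p} J₀ t s.1 s.2}
  have hstep : ∀ t (s : St t), ∃ s' : St (t + 1), (∀ j ≤ t, s'.1.1 j = s.1.1 j) ∧
      dist (s'.1.1 (t + 1)) (s.1.1 t.unpair.1) < 1 / (t + 1) := by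
    intro t s
    obtain ⟨x', Q', h1, h2, h3⟩ := s.2.step hf htyp (Nat.unpair_left_le t) t
    exact ⟨⟨(x', Q'), h1⟩, h2, h3⟩
  choose g hg1 hg2 using hstep
  let σ : ∀ t, St t := fun t => Nat.rec ⟨(fun _ => y, fun _ => R), Inv.init hR⟩ g t
  have hσ : ∀ t, σ (t + 1) = g t (σ t) := fun t => rfl
  let z : ℕ → X := fun i => (σ i).1.1 i
  have hz : ∀ i t, i ≤ t → (σ t).1.1 i = z i := by
    intro i t hit
    induction t, hit using Nat.le_induction with
    | base => rfl
    | succ t hit ih => rw [hσ, hg1 t _ i hit, ih]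
  have hz2 : ∀ i j, (σ (max i j)).1.1 i = z i ∧ (σ (max i j)).1.1 j = z j := fun i j =>
    ⟨hz _ _ (le_max_left _ _), hz _ _ (le_max_right _ _)⟩
  have hinj : ∀ i j, i ≠ j → z i ≠ z j := by
    intro i j hij
    rw [← (hz2 i j).1, ← (hz2 i j).2]
    exact (σ (max i j)).2.ne _ (le_max_left _ _) _ (le_max_right _ _) hij
  refine ⟨r, p, z, fun i j hij => by_contra fun h => hinj i j h hij, fun i j hij => ?_,
    fun i ε hε => ?_⟩
  · rw [← (hz2 i j).1, ← (hz2 i j).2]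
    exact (σ (max i j)).2.colour _ (le_max_left _ _) _ (le_max_right _ _) hij
  · obtain ⟨m, hm⟩ := exists_nat_one_div_lt hε
    have h2 : i ≤ Nat.pair i m := Nat.left_le_pair i m
    have h1 : dist (z (Nat.pair i m + 1)) (z i) < 1 / ((Nat.pair i m : ℕ) + 1) := by
      have h := hg2 (Nat.pair i m) (σ _)
      rw [Nat.unpair_pair] at h
      rw [← hz i _ h2]
      exact h
    refine ⟨Nat.pair i m + 1, by omega, h1.trans (lt_of_le_of_lt ?_ hm)⟩
    have : (m : ℝ) ≤ Nat.pair i m := by exact_mod_cast Nat.right_le_pair i m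
    gcongr

end Construction

section Sierpinski

open Set Filter Topology


/-- An approximation to a homeomorphism: a pair of mutually quasi-inverse locally constant
maps. -/
structure Approx (A B : Type*) [TopologicalSpace A] [TopologicalSpace B] where
  φ : A → B
  ψ : B → A
  hφ : IsLocallyConstant φ
  hψ : IsLocallyConstant ψ
  φψφ : ∀ x, φ (ψ (φ x)) = φ x
  ψφψ : ∀ y, ψ (φ (ψ y)) = ψ y

namespace Approx

section
variable {A B : Type*} [TopologicalSpace A] [TopologicalSpace B]

def swap (s : Approx A B) : Approx B A := ⟨s.ψ, s.φ, s.hψ, s.hφ, s.ψφψ, s.φψφ⟩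

structure Ext (s s' : Approx A B) : Prop where
  ψφ' : ∀ x, s.ψ (s'.φ x) = s.ψ (s.φ x)
  ψ'φ : ∀ x, s'.ψ (s.φ x) = s.ψ (s.φ x)
  φψ' : ∀ y, s.φ (s'.ψ y) = s.φ (s.ψ y)
  φ'ψ : ∀ y, s'.φ (s.ψ y) = s.φ (s.ψ y)

theorem Ext.swap {s s' : Approx A B} (h : Ext s s') : Ext s.swap s'.swap :=
  ⟨h.φψ', h.φ'ψ, h.ψφ', h.ψ'φ⟩

theorem Ext.refl (s : Approx A B) : Ext s s :=
  ⟨fun _ => rfl, fun _ => rfl, fun _ => rfl, fun _ => rfl⟩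

theorem Ext.comp_left {s₀ s₁ s₂ : Approx A B} (h : Ext s₀ s₁) (h' : Ext s₁ s₂) (x : A) :
    s₀.ψ (s₂.φ x) = s₀.ψ (s₀.φ x) := by
  have key : ∀ y, s₀.ψ y = s₀.ψ (s₀.φ (s₁.ψ y)) := fun y => by rw [h.φψ', s₀.ψφψ]
  rw [key, h'.ψφ', ← key, h.ψφ']

theorem Ext.comp_right {s₀ s₁ s₂ : Approx A B} (h : Ext s₀ s₁) (h' : Ext s₁ s₂) (x : A) :
    s₂.ψ (s₀.φ x) = s₀.ψ (s₀.φ x) := by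
  have key : s₀.φ x = s₁.φ (s₀.ψ (s₀.φ x)) := by rw [h.φ'ψ, s₀.φψφ]
  rw [key, h'.ψ'φ, ← key, h.ψ'φ]

theorem Ext.trans {s₀ s₁ s₂ : Approx A B} (h : Ext s₀ s₁) (h' : Ext s₁ s₂) : Ext s₀ s₂ :=
  ⟨h.comp_left h', h.comp_right h', h.swap.comp_left h'.swap, h.swap.comp_right h'.swap⟩

theorem Ext.mem_range {s s' : Approx A B} (h : Ext s s') {x : A} (hx : x ∈ range s.ψ) :
    x ∈ range s'.ψ := by
  obtain ⟨y, rfl⟩ := hx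
  exact ⟨s.φ (s.ψ y), by rw [h.ψ'φ, s.ψφψ]⟩

theorem isLocallyConstant_piecewise {A B : Type*} [TopologicalSpace A] {V : Set A}
    (hV : IsClopen V) [DecidablePred (· ∈ V)] {φ : A → B} (hφ : IsLocallyConstant φ) (y : B) :
    IsLocallyConstant (V.piecewise (fun _ => y) φ) := by
  rw [IsLocallyConstant.iff_eventually_eq]
  intro x
  by_cases hx : x ∈ V
  · filter_upwards [hV.isOpen.mem_nhds hx] with u hu
    simp [hx, hu]
  · filter_upwards [hV.compl.isOpen.mem_nhds hx, hφ.eventually_eq x] with u hu hu'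
    simp [hx, notMem_of_mem_compl hu, hu']

theorem exists_ext_of_clopen (s : Approx A B) {p x : A} {q y : B} (hp : s.φ p = q) (hq : s.ψ q = p)
    {V : Set A} {W : Set B} (hV : IsClopen V) (hW : IsClopen W) (hVs : ∀ u ∈ V, s.φ u = q)
    (hWs : ∀ v ∈ W, s.ψ v = p) (hx : x ∈ V) (hpV : p ∉ V) (hy : y ∈ W) (hqW : q ∉ W) :
    ∃ s' : Approx A B, Ext s s' ∧ s'.ψ y = x ∧ ∀ v ∉ W, s'.ψ v = s.ψ v ∧ ∀ v ∈ W, s'.ψ v = x := by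
  classical
  have h1 := s.φψφ
  have h2 := s.ψφψ
  refine ⟨⟨V.piecewise (fun _ => y) s.φ, W.piecewise (fun _ => x) s.ψ,
    isLocallyConstant_piecewise hV s.hφ y, isLocallyConstant_piecewise hW s.hψ x, ?_, ?_⟩,
    ⟨?_, ?_, ?_, ?_⟩, ?_, ?_⟩
  all_goals
    simp only [Set.piecewise]
    grind

end

section
variable {A B : Type*} [MetricSpace A] [MetricSpace B] [Countable A] [Countable B]

theorem exists_clopen_subset_ball (p : A) {ε : ℝ} (hε : 0 < ε) :
    ∃ N : Set A, IsClopen N ∧ p ∈ N ∧ N ⊆ Metric.ball p ε := by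
  obtain ⟨s, hs, h0, hsε⟩ :=
    ((countable_range fun x => dist x p).dense_compl ℝ).exists_between hε
  have : Metric.closedBall p s = Metric.ball p s := by
    ext x
    simp only [Metric.mem_closedBall, Metric.mem_ball]
    exact ⟨fun h => lt_of_le_of_ne h fun h' => hs ⟨x, h'⟩, le_of_lt⟩
  refine ⟨Metric.ball p s, ⟨?_, Metric.isOpen_ball⟩, Metric.mem_ball_self h0,
    Metric.ball_subset_ball hsε.le⟩
  rw [← this]
  exact Metric.isClosed_closedBall

theorem exists_ext (hA : ∀ (x : A), (𝓝[≠] x).NeBot) (hB : ∀ (y : B), (𝓝[≠] y).NeBot)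
    (s : Approx A B) (x : A) {ε : ℝ} (hε : 0 < ε) :
    ∃ s' : Approx A B, Ext s s' ∧ x ∈ range s'.ψ ∧
      ∀ y', s'.ψ y' = s.ψ (s.φ x) → dist y' (s.φ x) < ε := by
  set q := s.φ x with hq
  set p := s.ψ q with hp
  have hpq : s.φ p = q := s.φψφ x
  have hVo : {u | s.φ u = q} ∈ 𝓝 p := (s.hφ.isOpen_fiber q).mem_nhds hpq
  have hWo : {v | s.ψ v = p} ∈ 𝓝 q := (s.hψ.isOpen_fiber p).mem_nhds rfl
  obtain ⟨x₁, hx₁, hx₁p, hxx⟩ : ∃ x₁, s.φ x₁ = q ∧ x₁ ≠ p ∧ (x ≠ p → x₁ = x) := by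
    by_cases hxp : x = p
    · have := hA p
      obtain ⟨x₁, h1, h2⟩ := this.nonempty_of_mem
        (inter_mem (mem_nhdsWithin_of_mem_nhds hVo) (self_mem_nhdsWithin (s := {p}ᶜ)))
      exact ⟨x₁, h1, h2, fun h => absurd hxp h⟩
    · exact ⟨x, rfl, hxp, fun _ => rfl⟩
  obtain ⟨y₁, hy₁, hy₁q⟩ : ∃ y₁, s.ψ y₁ = p ∧ y₁ ≠ q := by
    have := hB q
    obtain ⟨y₁, h1, h2⟩ := this.nonempty_of_mem
      (inter_mem (mem_nhdsWithin_of_mem_nhds hWo) (self_mem_nhdsWithin (s := {q}ᶜ)))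
    exact ⟨y₁, h1, h2⟩
  obtain ⟨N, hN, hpN, hNb⟩ := exists_clopen_subset_ball p (dist_pos.2 hx₁p)
  obtain ⟨N', hN', hqN, hNb'⟩ := exists_clopen_subset_ball q (lt_min hε (dist_pos.2 hy₁q))
  obtain ⟨s', hs', h1, h2⟩ := s.exists_ext_of_clopen hpq rfl (x := x₁) (y := y₁)
    (V := {u | s.φ u = q} \ N) (W := {v | s.ψ v = p} \ N')
    ((s.hφ.isClopen_fiber q).diff hN) ((s.hψ.isClopen_fiber p).diff hN') (fun u hu => hu.1)
    (fun v hv => hv.1) ⟨hx₁, fun h => lt_irrefl _ (Metric.mem_ball.1 (hNb h))⟩ (fun h => h.2 hpN)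
    ⟨hy₁, fun h => lt_irrefl _ ((Metric.mem_ball.1 (hNb' h)).trans_le (min_le_right _ _))⟩
    (fun h => h.2 hqN)
  refine ⟨s', hs', ?_, fun y' hy' => ?_⟩
  · by_cases hxp : x = p
    · exact ⟨q, by rw [(h2 q (fun h => h.2 hqN)).1]; exact hxp.symm⟩
    · exact ⟨y₁, h1.trans (hxx hxp)⟩
  · have hW : y' ∉ {v | s.ψ v = p} \ N' := by
      intro hmem
      have := (h2 q (fun h => h.2 hqN)).2 y' hmem
      exact hx₁p (this.symm.trans hy')
    have hy'' : s.ψ y' = p := by rw [← (h2 y' hW).1, hy']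
    have : y' ∈ N' := by
      by_contra h
      exact hW ⟨hy'', h⟩
    exact (hNb' this).trans_le (min_le_left _ _)

end

section
variable {A B : Type*} [MetricSpace A] [MetricSpace B]

/-- The map `A → B` determined by an increasing sequence of approximations. -/
theorem exists_limit (σ : ℕ → Approx A B) (hσ : ∀ s t, s ≤ t → Ext (σ s) (σ t))
    (hsmall : ∀ x : A, ∀ ε > 0, ∃ t, x ∈ range (σ t).ψ ∧
      ∀ y', (σ (t + 1)).ψ y' = x → dist y' ((σ t).φ x) < ε) :
    ∃ f : A → B, Continuous f ∧ ∀ x t, x ∈ range (σ t).ψ → f x = (σ t).φ x := by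
  choose T hT using fun x => (hsmall x 1 one_pos).imp fun t h => h.1
  have hstab : ∀ x s t, x ∈ range (σ s).ψ → s ≤ t → (σ t).φ x = (σ s).φ x := by
    rintro _ s t ⟨y, rfl⟩ hst
    exact (hσ s t hst).φ'ψ y
  have hf : ∀ x t, x ∈ range (σ t).ψ → (σ (T x)).φ x = (σ t).φ x := by
    intro x t hx
    rcases le_total (T x) t with h | h
    · exact (hstab x _ _ (hT x) h).symm
    · exact hstab x _ _ hx h
  refine ⟨fun x => (σ (T x)).φ x, ?_, hf⟩
  rw [continuous_iff_continuousAt]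
  intro x
  rw [ContinuousAt, Metric.tendsto_nhds]
  intro ε hε
  obtain ⟨t, hxt, ht⟩ := hsmall x ε hε
  filter_upwards [(σ (t + 1)).hφ.eventually_eq x] with x' hx'
  rw [hf x t hxt]
  apply ht
  have h1 : x' ∈ range (σ (max (T x') (t + 1))).ψ := (hσ _ _ (le_max_left _ _)).mem_range (hT x')
  rw [hf x' _ h1, (hσ _ _ (le_max_right _ _)).ψφ', hx']
  obtain ⟨y, rfl⟩ := (hσ _ _ (Nat.le_succ t)).mem_range hxt
  exact (σ (t + 1)).ψφψ y

end

end Approx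

open Approx in
/-- **Sierpiński's theorem**: any two nonempty countable metric spaces without isolated points
are homeomorphic. -/
theorem nonempty_homeomorph {A B : Type*} [MetricSpace A] [MetricSpace B] [Countable A]
    [Countable B] [Nonempty A] [Nonempty B]
    (hA : ∀ (x : A), (𝓝[≠] x).NeBot) (hB : ∀ (y : B), (𝓝[≠] y).NeBot) : Nonempty (A ≃ₜ B) := by
  obtain ⟨a₀⟩ := ‹Nonempty A›
  obtain ⟨b₀⟩ := ‹Nonempty B›
  obtain ⟨e, he⟩ := exists_surjective_nat (A ⊕ B)
  have hstep : ∀ (s : Approx A B) (t : ℕ), ∃ s' : Approx A B, Ext s s' ∧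
      (∀ x, e t.unpair.1 = Sum.inl x → x ∈ range s'.ψ ∧
        ∀ y', s'.ψ y' = s.ψ (s.φ x) → dist y' (s.φ x) < 1 / (t + 1)) ∧
      (∀ y, e t.unpair.1 = Sum.inr y → y ∈ range s'.φ ∧
        ∀ x', s'.φ x' = s.φ (s.ψ y) → dist x' (s.ψ y) < 1 / (t + 1)) := by
    intro s t
    have ht : (0 : ℝ) < 1 / (t + 1) := by positivity
    rcases e t.unpair.1 with x | y
    · obtain ⟨s', h1, h2, h3⟩ := s.exists_ext hA hB x ht
      refine ⟨s', h1, fun x' hx' => ?_, fun y hy => by simp at hy⟩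
      obtain rfl := Sum.inl_injective hx'
      exact ⟨h2, h3⟩
    · obtain ⟨s', h1, h2, h3⟩ := s.swap.exists_ext hB hA y ht
      refine ⟨s'.swap, h1.swap, fun y hy => by simp at hy, fun y' hy' => ?_⟩
      obtain rfl := Sum.inr_injective hy'
      exact ⟨h2, h3⟩
  choose g hg1 hg2 hg3 using hstep
  let s₀ : Approx A B := ⟨fun _ => b₀, fun _ => a₀, IsLocallyConstant.const _,
    IsLocallyConstant.const _, fun _ => rfl, fun _ => rfl⟩
  obtain ⟨σ, hσ'⟩ : ∃ σ : ℕ → Approx A B, ∀ t, σ (t + 1) = g (σ t) t :=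
    ⟨fun t => Nat.rec s₀ (fun t s => g s t) t, fun t => rfl⟩
  have hσ1 : ∀ t, Ext (σ t) (σ (t + 1)) := fun t => hσ' t ▸ hg1 _ _
  replace hg2 := fun t => hσ' t ▸ hg2 (σ t) t
  replace hg3 := fun t => hσ' t ▸ hg3 (σ t) t
  have hσ : ∀ s t, s ≤ t → Ext (σ s) (σ t) := by
    intro s t hst
    induction t, hst using Nat.le_induction with
    | base => exact Ext.refl _
    | succ t _ ih => exact ih.trans (hσ1 t)
  have hname : ∀ x m, e m = Sum.inl x → x ∈ range (σ (Nat.pair m 0 + 1)).ψ := fun x m hm =>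
    (hg2 (Nat.pair m 0) x (by rw [Nat.unpair_pair, hm])).1
  have hname' : ∀ y m, e m = Sum.inr y → y ∈ range (σ (Nat.pair m 0 + 1)).φ := fun y m hm =>
    (hg3 (Nat.pair m 0) y (by rw [Nat.unpair_pair, hm])).1
  have htime : ∀ (m : ℕ) (ε : ℝ), 0 < ε → ∃ t : ℕ, t.unpair.1 = m ∧ Nat.pair m 0 + 1 ≤ t ∧
      (1 : ℝ) / (t + 1) < ε := by
    intro m ε hε
    obtain ⟨k, hk⟩ := exists_nat_one_div_lt hε
    refine ⟨Nat.pair m (max k (Nat.pair m 0 + 1)), by rw [Nat.unpair_pair],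
      (le_max_right _ _).trans (Nat.right_le_pair _ _), lt_of_le_of_lt ?_ hk⟩
    have : (k : ℝ) ≤ Nat.pair m (max k (Nat.pair m 0 + 1)) := by
      exact_mod_cast (le_max_left _ _).trans (Nat.right_le_pair _ _)
    gcongr
  obtain ⟨F, hF, hF'⟩ := exists_limit σ hσ
    (fun x ε hε => by
      obtain ⟨m, hm⟩ := he (Sum.inl x)
      obtain ⟨t, rfl, hmt, ht⟩ := htime m ε hε
      have hx := (hσ _ _ hmt).mem_range (hname x _ hm)
      refine ⟨t, hx, fun y' hy' => ((hg2 t x hm).2 y' ?_).trans ht⟩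
      obtain ⟨y, rfl⟩ := hx
      rw [(σ t).ψφψ]
      exact hy')
  obtain ⟨G, hG, hG'⟩ := exists_limit (fun t => (σ t).swap) (fun s t h => (hσ s t h).swap)
    (fun y ε hε => by
      obtain ⟨m, hm⟩ := he (Sum.inr y)
      obtain ⟨t, rfl, hmt, ht⟩ := htime m ε hε
      have hy : y ∈ range (σ t).φ := (hσ _ _ hmt).swap.mem_range (hname' y _ hm)
      refine ⟨t, hy, fun x' hx' => ((hg3 t y hm).2 x' ?_).trans ht⟩
      obtain ⟨x, rfl⟩ := hy
      rw [(σ t).φψφ]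
      exact hx')
  replace hG' : ∀ y t, y ∈ range (σ t).φ → G y = (σ t).ψ y := hG'
  refine ⟨⟨⟨F, G, fun x => ?_, fun y => ?_⟩, hF, hG⟩⟩
  · obtain ⟨m, hm⟩ := he (Sum.inl x)
    obtain ⟨y, hy⟩ := hname x m hm
    rw [hF' x (Nat.pair m 0 + 1) ⟨y, hy⟩, hG' _ (Nat.pair m 0 + 1) ⟨x, rfl⟩, ← hy]
    exact (σ _).ψφψ y
  · obtain ⟨m, hm⟩ := he (Sum.inr y)
    obtain ⟨x, hx⟩ := hname' y m hm
    rw [hG' y (Nat.pair m 0 + 1) ⟨x, hx⟩, hF' _ (Nat.pair m 0 + 1) ⟨y, rfl⟩, ← hx]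
    exact (σ _).φψφ x

end Sierpinski

section Main

open Obj

theorem exists_homeomorph_rat_pairColours_subset {X : Type*} [MetricSpace X]
    (hX : ¬ ∃ Y : ℕ → Set X, (∀ n, DiscreteTopology ↥(Y n)) ∧ (⋃ n, Y n) = Set.univ)
    {K : ℕ} (c : Sym2 X → Fin K) :
    ∃ (Y : Set X) (r p : Fin K), Nonempty (↥Y ≃ₜ ℚ) ∧ pairColours c Y ⊆ {r, p} := by
  obtain ⟨r, p, z, hz, hrp, hd⟩ := exists_dense_in_itself_seq (f := fun x y => c s(x, y))
    (fun x y => by rw [Sym2.eq_swap]) (by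
      refine (frequently_not_closed hX pt_injective).mono ?_
      rintro M ⟨y, h1, h2⟩
      exact ⟨y, h1, h2, by simp⟩)
  have := (Set.countable_range z).to_subtype
  refine ⟨Set.range z, r, p, nonempty_homeomorph ?_ fun _ => inferInstance, ?_⟩
  · rintro ⟨_, i, rfl⟩
    rw [← mem_closure_iff_nhdsWithin_neBot, Metric.mem_closure_iff]
    intro ε hε
    obtain ⟨j, hj, hji⟩ := hd i ε hε
    exact ⟨⟨z j, j, rfl⟩, fun h => hj (hz (congrArg Subtype.val h)), by
      rw [dist_comm]; exact hji⟩
  · rintro _ ⟨_, ⟨i, rfl⟩, _, ⟨j, rfl⟩, hij, rfl⟩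
    exact hrp i j fun h => hij (congrArg z h)

end Main

end GalvinMetric

/-- Corollary E: if `X` is a metric space which is not σ-discrete, then for every colouring
of pairs of points of `X` into finitely many colours there is `Y ⊆ X` homeomorphic to `ℚ`
with `|c''[Y]²| ≤ 2`. -/
theorem galvin_conjecture_metric (X : Type*) [MetricSpace X]
    (hX : ¬ ∃ Y : ℕ → Set X, (∀ n, DiscreteTopology ↥(Y n)) ∧ (⋃ n, Y n) = Set.univ)
    (K : ℕ) (hK : 0 < K) (c : Sym2 X → Fin K) :
    ∃ Y : Set X, Nonempty (↥Y ≃ₜ ℚ) ∧ (pairColours c Y).ncard ≤ 2 := by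
  obtain ⟨Y, r, p, hY, hc⟩ := GalvinMetric.exists_homeomorph_rat_pairColours_subset hX c
  exact ⟨Y, hY, (Set.ncard_le_ncard hc).trans ((Set.ncard_insert_le r {p}).trans (by simp))⟩
end

section
/- Let X be a metric space. Then there is a colouring c assigning to each unordered pair of distinct points of X a natural number such that for every Y ⊆ X which is not discrete in the subspace topology, the set c''[Y]² of values taken by c on pairs of distinct elements of Y is infinite. -/
/-- Lemma 1.3: every metric space admits a colouring of pairs by natural numbers which takes
infinitely many values on every non-discrete subspace. -/
theorem metric_colouring_infinite_on_nondiscrete (X : Type*) [MetricSpace X] :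
    ∃ c : Sym2 X → ℕ, ∀ Y : Set X, ¬ DiscreteTopology ↥Y →
      {n : ℕ | ∃ x ∈ Y, ∃ y ∈ Y, x ≠ y ∧ c s(x, y) = n}.Infinite := by
  refine ⟨Sym2.lift ⟨fun x y => ⌊(dist x y)⁻¹⌋₊, fun x y => by simp only [dist_comm]⟩,
    fun Y hY hfin => hY ?_⟩
  obtain ⟨N, hN⟩ := hfin.bddAbove
  have hr : (0 : ℝ) < ((N : ℝ) + 1)⁻¹ := by positivity
  refine DiscreteTopology.of_forall_le_dist hr fun x y hxy => ?_
  have hne : (x : X) ≠ y := Subtype.coe_injective.ne hxy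
  have hle : ⌊(dist (x : X) y)⁻¹⌋₊ ≤ N := hN ⟨x, x.2, y, y.2, hne, rfl⟩
  have hlt : (dist (x : X) y)⁻¹ < (N : ℝ) + 1 := by
    exact_mod_cast (Nat.floor_lt' N.succ_ne_zero).1 (Nat.lt_succ_of_le hle)
  exact (inv_lt_of_inv_lt₀ (dist_pos.2 hne) hlt).le
end

section
/- Let X be a metric space. Then there is a colouring c assigning to each unordered pair of distinct points of X a colour in {0,1} such that for every nonempty Y ⊆ X which is dense-in-itself, c takes both values on pairs of distinct elements of Y, i.e. c''[Y]² = {0,1}. -/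
open Filter Topology

/-- `x` precedes `y` lexicographically with respect to the sequence of maps `f`. -/
def LexLT {X β : Type*} [LT β] (f : ℕ → X → β) (x y : X) : Prop :=
  ∃ n, (∀ m < n, f m x = f m y) ∧ f n x < f n y

theorem LexLT.lt_of_ne {X β : Type*} [Preorder β] {f : ℕ → X → β} {x y : X} (h : LexLT f x y)
    {k : ℕ} (hk : ∀ m < k, f m x = f m y) (hne : f k x ≠ f k y) : f k x < f k y := by
  obtain ⟨n, hn, hlt⟩ := h
  rcases lt_trichotomy n k with h | rfl | h
  · exact absurd (hk n h) hlt.ne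
  · exact hlt
  · exact absurd (hn k h) hne

theorem lexLT_or_lexLT {X β : Type*} [LinearOrder β] {f : ℕ → X → β} {x y : X}
    (h : ∃ n, f n x ≠ f n y) : LexLT f x y ∨ LexLT f y x := by
  classical
  have hmin : ∀ m < Nat.find h, f m x = f m y := fun m hm => not_not.1 (Nat.find_min h hm)
  rcases lt_or_gt_of_ne (Nat.find_spec h) with hlt | hlt
  · exact Or.inl ⟨_, hmin, hlt⟩
  · exact Or.inr ⟨_, fun m hm => (hmin m hm).symm, hlt⟩

/-- A set on which a well-order agrees with a lexicographic order has an isolated point, provided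
each coordinate is upper semicontinuous on the fibres of the preceding ones. -/
theorem exists_notMem_closure_of_lexLT {X β : Type*} [TopologicalSpace X] [LinearOrder X]
    [WellFoundedLT X] [LinearOrder β] {f : ℕ → X → β}
    (hf : ∀ n x y, f n x < f n y →
      ∀ᶠ z in 𝓝 x, (∀ m < n, f m z = f m x) → f n z < f n y)
    {Y : Set X} (hY : Y.Nonempty) (hmono : ∀ x ∈ Y, ∀ y ∈ Y, x < y → LexLT f x y) :
    ∃ y ∈ Y, y ∉ closure (Y \ {y}) := by
  obtain ⟨a, haY, ha⟩ := WellFounded.has_min (wellFounded_lt (α := X)) Y hY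
  have fibre : ∀ k, ∀ᶠ z in 𝓝 a, z ∈ Y → ∀ m < k, f m z = f m a := by
    intro k
    induction k with
    | zero => simp
    | succ k ih =>
      by_cases hex : {y ∈ Y | (∀ m < k, f m y = f m a) ∧ f k y ≠ f k a}.Nonempty
      · obtain ⟨b, ⟨hbY, hbk, hbne⟩, hb⟩ :=
          WellFounded.has_min (wellFounded_lt (α := X)) _ hex
        have hab : a < b :=
          lt_of_le_of_ne (not_lt.1 (ha b hbY)) fun h => hbne (by rw [h])
        have hlt := (hmono a haY b hbY hab).lt_of_ne (fun m hm => (hbk m hm).symm) hbne.symm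
        filter_upwards [ih, hf k a b hlt] with z hz hzb hzY m hm
        rcases Nat.lt_succ_iff_lt_or_eq.1 hm with hm | rfl
        · exact hz hzY m hm
        · by_contra hne
          have hzlt := hzb (hz hzY)
          have hbz : b < z := lt_of_le_of_ne (not_lt.1 (hb z ⟨hzY, hz hzY, hne⟩)) fun h =>
            hzlt.ne (by rw [h])
          exact lt_asymm hzlt ((hmono b hbY z hzY hbz).lt_of_ne
            (fun i hi => (hbk i hi).trans (hz hzY i hi).symm) hzlt.ne')
      · filter_upwards [ih] with z hz hzY m hm
        rcases Nat.lt_succ_iff_lt_or_eq.1 hm with hm | rfl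
        · exact hz hzY m hm
        · by_contra hne
          exact hex ⟨z, hzY, hz hzY, hne⟩
  refine ⟨a, haY, ?_⟩
  rcases (Y \ {a}).eq_empty_or_nonempty with hemp | hne
  · simp [hemp]
  obtain ⟨b, ⟨hbY, hba⟩, hb⟩ := WellFounded.has_min (wellFounded_lt (α := X)) _ hne
  have hab : a < b := lt_of_le_of_ne (not_lt.1 (ha b hbY)) (Ne.symm hba)
  obtain ⟨n, hn, hlt⟩ := hmono a haY b hbY hab
  rw [mem_closure_iff_frequently, not_frequently]
  filter_upwards [fibre (n + 1)] with z hz hzmem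
  have hzn := hz hzmem.1
  have hzlt : f n z < f n b := (hzn n n.lt_succ_self).trans_lt hlt
  have hbz : b < z := lt_of_le_of_ne (not_lt.1 (hb z hzmem)) fun h => hzlt.ne (by rw [h])
  exact lt_asymm hzlt ((hmono b hbY z hzmem.1 hbz).lt_of_ne
    (fun i hi => ((hn i hi).symm.trans (hzn i (hi.trans n.lt_succ_self)).symm)) hzlt.ne')

/-- The points at which `A` is maximal on the ball of radius `ε`. -/
def localMaxSet {X κ : Type*} [PseudoMetricSpace X] [LE κ] (A : X → κ) (ε : ℝ) : Set X :=
  {x | ∀ y, dist x y < ε → A y ≤ A x}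

theorem eq_of_mem_localMaxSet {X κ : Type*} [PseudoMetricSpace X] [PartialOrder κ] {A : X → κ}
    {ε : ℝ} {x y : X} (hx : x ∈ localMaxSet A ε) (hy : y ∈ localMaxSet A ε) (h : dist x y < ε) :
    A x = A y :=
  le_antisymm (hy x (by rwa [dist_comm])) (hx y h)

theorem isClosed_localMaxSet {X κ : Type*} [PseudoMetricSpace X] [PartialOrder κ] {A : X → κ}
    (hA : ∀ x, ∀ᶠ y in 𝓝 x, A y ≤ A x) (ε : ℝ) : IsClosed (localMaxSet A ε) := by
  refine isClosed_of_closure_subset fun z hz y hzy => ?_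
  have hε : 0 < ε := dist_nonneg.trans_lt hzy
  have hy : ∀ᶠ x in 𝓝 z, dist x y < ε :=
    (continuous_id.dist continuous_const).continuousAt.eventually_lt continuousAt_const hzy
  obtain ⟨x, hx, hxz, hxy⟩ :=
    ((mem_closure_iff_frequently.1 hz).and_eventually ((hA z).and hy)).exists
  exact (hx y hxy).trans hxz

open Classical in
/-- The value of `A` on `localMaxSet A ε`, and `⊥` elsewhere. -/
noncomputable def localMaxValue {X κ : Type*} [PseudoMetricSpace X] [LE κ] (A : X → κ) (ε : ℝ)
    (x : X) : WithBot κ :=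
  if x ∈ localMaxSet A ε then (A x : WithBot κ) else ⊥

theorem eventually_localMaxValue_eq {X κ : Type*} [PseudoMetricSpace X] [PartialOrder κ]
    {A : X → κ} (hA : ∀ x, ∀ᶠ y in 𝓝 x, A y ≤ A x) {ε : ℝ} (hε : 0 < ε) (x : X) :
    ∀ᶠ z in 𝓝 x, Metric.infEDist z (localMaxSet A ε) = Metric.infEDist x (localMaxSet A ε) →
      localMaxValue A ε z = localMaxValue A ε x := by
  filter_upwards [Metric.ball_mem_nhds x hε] with z hz heq
  have hiff : z ∈ localMaxSet A ε ↔ x ∈ localMaxSet A ε := by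
    rw [Metric.mem_iff_infEDist_zero_of_closed (isClosed_localMaxSet hA ε), heq,
      ← Metric.mem_iff_infEDist_zero_of_closed (isClosed_localMaxSet hA ε)]
  by_cases hx : x ∈ localMaxSet A ε
  · simp [localMaxValue, hx, hiff, eq_of_mem_localMaxSet (hiff.2 hx) hx hz]
  · simp [localMaxValue, hx, hiff]

theorem exists_separating_usc {X : Type*} [MetricSpace X] [LinearOrder X] [WellFoundedLT X]
    {r : ℝ} (hr : 0 < r) :
    ∃ A : X → X, (∀ x, ∀ᶠ y in 𝓝 x, A y ≤ A x) ∧ ∀ x, dist x (A x) < r := by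
  have hmin : ∀ x : X, ∃ a, dist x a < r ∧ ∀ b, dist x b < r → a ≤ b := fun x => by
    obtain ⟨a, ha, h⟩ := WellFounded.has_min (wellFounded_lt (α := X)) {a | dist x a < r}
      ⟨x, by simpa using hr⟩
    exact ⟨a, ha, fun b hb => not_lt.1 (h b hb)⟩
  choose A hA hAmin using hmin
  refine ⟨A, fun x => ?_, hA⟩
  have : ∀ᶠ y in 𝓝 x, dist y (A x) < r :=
    (continuous_id.dist continuous_const).continuousAt.eventually_lt continuousAt_const (hA x)
  filter_upwards [this] with y hy using hAmin y _ hy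

/-- A metric space carries countably many continuous functions `t m` and functions `α m`, the
latter locally constant on the fibres of the former, which together separate points. -/
theorem exists_separating_sequences (X : Type*) [MetricSpace X] [LinearOrder X]
    [WellFoundedLT X] :
    ∃ (t : ℕ → X → ENNReal) (α : ℕ → X → WithBot X), (∀ m, Continuous (t m)) ∧
      (∀ m x, ∀ᶠ z in 𝓝 x, t m z = t m x → α m z = α m x) ∧
      ∀ x y, (∀ m, t m x = t m y) → (∀ m, α m x = α m y) → x = y := by
  have hpos : ∀ k : ℕ, (0 : ℝ) < 1 / (k + 1) := fun k => Nat.one_div_pos_of_nat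
  choose A hA hdist using fun k : ℕ => exists_separating_usc (X := X) (hpos k)
  refine ⟨fun m x => Metric.infEDist x (localMaxSet (A m.unpair.1) (1 / (m.unpair.2 + 1))),
    fun m => localMaxValue (A m.unpair.1) (1 / (m.unpair.2 + 1)),
    fun m => Metric.continuous_infEDist,
    fun m x => eventually_localMaxValue_eq (hA _) (hpos _) x, fun x y ht hα => ?_⟩
  by_contra hne
  obtain ⟨k, hk⟩ := exists_nat_one_div_lt (half_pos (dist_pos.2 hne))
  obtain ⟨ε, hε, hball⟩ := Metric.eventually_nhds_iff.1 (hA k x)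
  obtain ⟨n, hn⟩ := exists_nat_one_div_lt hε
  have hx : x ∈ localMaxSet (A k) (1 / (n + 1)) := fun z hz =>
    hball (by rw [dist_comm]; exact hz.trans hn)
  have hcl := isClosed_localMaxSet (hA k) (1 / (n + 1))
  have htn := ht (Nat.pair k n)
  have hαn := hα (Nat.pair k n)
  simp only [Nat.unpair_pair] at htn hαn
  have hy : y ∈ localMaxSet (A k) (1 / (n + 1)) := by
    rwa [Metric.mem_iff_infEDist_zero_of_closed hcl, ← htn,
      ← Metric.mem_iff_infEDist_zero_of_closed hcl]
  simp only [localMaxValue, hx, hy, if_true, WithBot.coe_inj] at hαn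
  have h1 := hdist k x
  have h2 := hdist k y
  rw [← hαn] at h2
  linarith [dist_triangle_right x y (A k x)]

/-- A metric space carries a point-separating sequence of maps to a linear order, each of which
is continuous on the fibres of the preceding ones. -/
theorem exists_separating_lex_sequence (X : Type*) [MetricSpace X] [LinearOrder X]
    [WellFoundedLT X] :
    ∃ f : ℕ → X → Lex (ENNReal ⊕ WithBot X),
      (∀ n x y, f n x < f n y →
        ∀ᶠ z in 𝓝 x, (∀ m < n, f m z = f m x) → f n z < f n y) ∧
      (∀ n x y, f n y < f n x →
        ∀ᶠ z in 𝓝 x, (∀ m < n, f m z = f m x) → f n y < f n z) ∧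
      ∀ x y, x ≠ y → ∃ n, f n x ≠ f n y := by
  obtain ⟨t, α, ht, hα, hsep⟩ := exists_separating_sequences X
  let f : ℕ → X → Lex (ENNReal ⊕ WithBot X) := fun n x =>
    if n % 2 = 0 then toLex (Sum.inl (t (n / 2) x)) else toLex (Sum.inr (α (n / 2) x))
  have heven : ∀ m x, f (2 * m) x = toLex (Sum.inl (t m x)) := fun m x => by simp [f]
  have hodd : ∀ m x, f (2 * m + 1) x = toLex (Sum.inr (α m x)) := fun m x => by
    have h1 : (2 * m + 1) % 2 = 1 := by omega
    have h2 : (2 * m + 1) / 2 = m := by omega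
    simp [f, h1, h2]
  have hconst : ∀ m x, ∀ᶠ z in 𝓝 x, (∀ i < 2 * m + 1, f i z = f i x) →
      f (2 * m + 1) z = f (2 * m + 1) x := fun m x => by
    filter_upwards [hα m x] with z hz hzi
    have := hzi (2 * m) (by omega)
    rw [heven, heven] at this
    rw [hodd, hodd, hz (Sum.inl_injective (toLex.injective this))]
  refine ⟨f, fun n x y hlt => ?_, fun n x y hlt => ?_, fun x y hne => ?_⟩
  · obtain ⟨m, rfl | rfl⟩ := n.even_or_odd'
    · simp only [heven, Sum.Lex.inl_lt_inl_iff] at hlt ⊢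
      filter_upwards [(ht m).continuousAt.eventually_lt continuousAt_const hlt] with z hz _ using hz
    · filter_upwards [hconst m x] with z hz hzi using (hz hzi).trans_lt hlt
  · obtain ⟨m, rfl | rfl⟩ := n.even_or_odd'
    · simp only [heven, Sum.Lex.inl_lt_inl_iff] at hlt ⊢
      filter_upwards [continuousAt_const.eventually_lt (ht m).continuousAt hlt] with z hz _ using hz
    · filter_upwards [hconst m x] with z hz hzi using hlt.trans_eq (hz hzi).symm
  · by_contra! h
    refine hne (hsep x y (fun m => ?_) fun m => ?_)
    · simpa [heven] using h (2 * m)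
    · simpa [hodd] using h (2 * m + 1)

/-- Lemma 1.4 (Sierpiński-type colouring for metric spaces): every metric space admits a
2-colouring of pairs realising both colours on every nonempty dense-in-itself subset. -/
theorem metric_sierpinski_colouring (X : Type*) [MetricSpace X] :
    ∃ c : Sym2 X → Fin 2, ∀ Y : Set X, Y.Nonempty →
      (∀ y ∈ Y, y ∈ closure (Y \ {y})) →
      {k : Fin 2 | ∃ x ∈ Y, ∃ y ∈ Y, x ≠ y ∧ c s(x, y) = k} = Set.univ := by
  classical
  obtain ⟨_, _⟩ := exists_wellFoundedLT X
  obtain ⟨f, hlow, hupp, hsep⟩ := exists_separating_lex_sequence X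
  have hsymm : Std.Symm fun x y => (x < y ∧ LexLT f x y) ∨ (y < x ∧ LexLT f y x) :=
    ⟨fun _ _ => Or.symm⟩
  refine ⟨fun p => if p ∈ Sym2.fromRel hsymm then 1 else 0, fun Y hY hdense =>
    Set.eq_univ_of_forall fun k => ?_⟩
  by_contra hk
  simp only [Set.mem_ofPred_eq, Sym2.fromRel_prop] at hk
  push Not at hk
  suffices ∃ y ∈ Y, y ∉ closure (Y \ {y}) by
    obtain ⟨y, hy, hcl⟩ := this
    exact hcl (hdense y hy)
  obtain rfl | rfl : k = 0 ∨ k = 1 := by omega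
  · refine exists_notMem_closure_of_lexLT hlow hY fun x hx y hy hxy => ?_
    by_contra hlex
    exact hk x hx y hy hxy.ne (if_neg (by simp [hlex, hxy.not_gt]))
  · refine exists_notMem_closure_of_lexLT (β := (Lex (ENNReal ⊕ WithBot X))ᵒᵈ)
      (f := fun n x => OrderDual.toDual (f n x)) hupp hY fun x hx y hy hxy => ?_
    rcases lexLT_or_lexLT (hsep x y hxy.ne) with hlex | ⟨n, hn, hlt⟩
    · exact absurd (if_pos (Or.inl ⟨hxy, hlex⟩)) (hk x hx y hy hxy.ne)
    · exact ⟨n, fun m hm => (hn m hm).symm, hlt⟩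
end

section
/- Let H be a nonempty set, let I be a fine ideal on P_{ω1}(H), and let f : P_{ω1}(H) → Ordinals. Define I[f, I] := I ∪ {A ∈ I⁺ : rk_{I+A}(f) > rk_I(f)}. Then I[f, I] is a fine ideal on P_{ω1}(H) extending I. -/
namespace Galvin

/-- `P_{ω₁}(H)`: the collection of countable subsets of `H`. -/
def Pom (H : Type u) : Set (Set H) := {M : Set H | M.Countable}

/-- An ideal on `P_{ω₁}(H)`: a proper collection of subsets of `P_{ω₁}(H)` closed under
subsets and finite unions. -/
structure IsIdeal (H : Type u) (I : Set (Set (Set H))) : Prop where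
  subset_pom : ∀ A ∈ I, A ⊆ Pom H
  empty_mem : (∅ : Set (Set H)) ∈ I
  subset_mem : ∀ A ∈ I, ∀ B : Set (Set H), B ⊆ A → B ∈ I
  union_mem : ∀ A ∈ I, ∀ B ∈ I, A ∪ B ∈ I
  proper : Pom H ∉ I

/-- ℵ₁-completeness: closure under countable unions. -/
def IsComplete {H : Type u} (I : Set (Set (Set H))) : Prop :=
  ∀ A : ℕ → Set (Set H), (∀ n, A n ∈ I) → (⋃ n, A n) ∈ I

/-- A fine ideal: an ℵ₁-complete ideal containing `{M : x ∉ M}` for every `x ∈ H`. -/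
def IsFineIdeal (H : Type u) (I : Set (Set (Set H))) : Prop :=
  IsIdeal H I ∧ IsComplete I ∧ ∀ x : H, {M ∈ Pom H | x ∉ M} ∈ I

/-- Normality: closure under diagonal unions. -/
def IsNormal (H : Type u) (I : Set (Set (Set H))) : Prop :=
  ∀ A : H → Set (Set H), (∀ x, A x ∈ I) → {M ∈ Pom H | ∃ x ∈ M, M ∈ A x} ∈ I

/-- `I⁺`: the `I`-positive subsets of `P_{ω₁}(H)`. -/
def pos (H : Type u) (I : Set (Set (Set H))) : Set (Set (Set H)) :=
  {A | A ⊆ Pom H ∧ A ∉ I}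

/-- `I*`: the dual filter of `I`. -/
def star (H : Type u) (I : Set (Set (Set H))) : Set (Set (Set H)) :=
  {A | Pom H \ A ∈ I}

/-- `I + A`: the ideal `{B : B ∩ A ∈ I}`. -/
def add (H : Type u) (I : Set (Set (Set H))) (A : Set (Set H)) : Set (Set (Set H)) :=
  {B | B ⊆ Pom H ∧ B ∩ A ∈ I}

end Galvin
namespace Galvin

/-- `f <_I g`: `f` is less than `g` modulo the ideal `I`. -/
def ltIdeal (H : Type u) (I : Set (Set (Set H))) (f g : Set H → Ordinal.{v}) : Prop :=
  {M ∈ Pom H | ¬ f M < g M} ∈ I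

/-- `f ≤_I g`: `f` is at most `g` modulo the ideal `I`. -/
def leIdeal (H : Type u) (I : Set (Set (Set H))) (f g : Set H → Ordinal.{v}) : Prop :=
  {M ∈ Pom H | ¬ f M ≤ g M} ∈ I

/-- `rk_I(f)`: the rank of `f` in the relation `<_I` (which is well-founded whenever `I` is
ℵ₁-complete); junk value `0` in the degenerate non-well-founded case. -/
noncomputable def rk (H : Type u) (I : Set (Set (Set H))) (f : Set H → Ordinal.{v}) :
    Ordinal :=
  letI := Classical.dec (WellFounded (ltIdeal.{u, v} H I))
  if h : WellFounded (ltIdeal.{u, v} H I) then (h.apply f).rank else 0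

end Galvin

namespace Galvin

theorem IsFineIdeal.isComplete_add {H : Type u} {I : Set (Set (Set H))} (hI : IsFineIdeal H I)
    (A : Set (Set H)) : IsComplete (add H I A) := by
  intro B hB
  refine ⟨Set.iUnion_subset fun n => (hB n).1, ?_⟩
  rw [Set.iUnion_inter]
  exact hI.2.1 _ fun n => (hB n).2

/-- An ℵ₁-complete proper ideal induces a well-founded strict order on ordinal functions. -/
theorem wellFounded_ltIdeal {H : Type u} {J : Set (Set (Set H))} (hJ : IsComplete J)
    (hsub : ∀ A ∈ J, ∀ B : Set (Set H), B ⊆ A → B ∈ J) (hproper : Pom H ∉ J) :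
    WellFounded (ltIdeal.{u, v} H J) := by
  rw [wellFounded_iff_isEmpty_descending_chain]
  refine ⟨fun ⟨f, hf⟩ => hproper (hsub _ (hJ _ hf) _ fun M hM => ?_)⟩
  by_contra hbad
  simp only [Set.mem_iUnion, not_exists] at hbad
  have hdec : ∀ n, f (n + 1) M < f n M := fun n => by
    by_contra h
    exact hbad n ⟨hM, h⟩
  exact (wellFounded_iff_isEmpty_descending_chain.1
    (Ordinal.lt_wf : WellFounded ((· < ·) : Ordinal → Ordinal → Prop))).false
    ⟨fun n => f n M, hdec⟩

theorem IsFineIdeal.wellFounded_add {H : Type u} {I : Set (Set (Set H))} (hI : IsFineIdeal H I)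
    {A : Set (Set H)} (hA : A ∈ pos H I) : WellFounded (ltIdeal.{u, v} H (add H I A)) := by
  refine wellFounded_ltIdeal (hI.isComplete_add A) (fun B hB C hCB =>
    ⟨hCB.trans hB.1, hI.1.subset_mem _ hB.2 _ (Set.inter_subset_inter_left _ hCB)⟩) fun h => ?_
  have := h.2
  rw [Set.inter_eq_right.2 hA.1] at this
  exact hA.2 this

theorem IsFineIdeal.add_mono {H : Type u} {I : Set (Set (Set H))} (hI : IsFineIdeal H I)
    {A B : Set (Set H)} (hBA : B ⊆ A) : add H I A ⊆ add H I B :=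
  fun _ hC => ⟨hC.1, hI.1.subset_mem _ hC.2 _ (Set.inter_subset_inter_right _ hBA)⟩

theorem IsFineIdeal.add_pom {H : Type u} {I : Set (Set (Set H))} (hI : IsFineIdeal H I) :
    add H I (Pom H) = I := by
  ext B
  constructor
  · rintro ⟨hB, h⟩
    rwa [Set.inter_eq_left.2 hB] at h
  · intro h
    have hB := hI.1.subset_pom B h
    exact ⟨hB, by rwa [Set.inter_eq_left.2 hB]⟩

theorem ltIdeal_add_iff {H : Type u} {I : Set (Set (Set H))} {A : Set (Set H)}
    {f g : Set H → Ordinal.{v}} (hA : A ⊆ Pom H) :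
    ltIdeal H (add H I A) f g ↔ {M ∈ A | ¬ f M < g M} ∈ I := by
  have : {M ∈ Pom H | ¬ f M < g M} ∩ A = {M ∈ A | ¬ f M < g M} := by
    ext M
    exact ⟨fun h => ⟨h.2, h.1.2⟩, fun h => ⟨⟨hA h.1, h.2⟩, h.1⟩⟩
  constructor
  · intro h
    rw [← this]
    exact h.2
  · intro h
    refine ⟨fun M hM => hM.1, ?_⟩
    rwa [this]

theorem rk_eq_rank {H : Type u} {J : Set (Set (Set H))} (hJ : WellFounded (ltIdeal.{u, v} H J))
    (f : Set H → Ordinal.{v}) : rk H J f = (hJ.apply f).rank := by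
  rw [rk, dif_pos hJ]

theorem rk_lt_rk {H : Type u} {J : Set (Set (Set H))} (hJ : WellFounded (ltIdeal.{u, v} H J))
    {f g : Set H → Ordinal.{v}} (h : ltIdeal H J g f) : rk H J g < rk H J f := by
  rw [rk_eq_rank hJ, rk_eq_rank hJ]
  exact (hJ.apply f).rank_lt_of_rel h

theorem rk_le {H : Type u} {J : Set (Set (Set H))} (hJ : WellFounded (ltIdeal.{u, v} H J))
    {f : Set H → Ordinal.{v}} {α : Ordinal} (h : ∀ g, ltIdeal H J g f → rk H J g < α) :
    rk H J f ≤ α := by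
  rw [rk_eq_rank hJ, Acc.rank_eq]
  refine Ordinal.iSup_le fun ⟨g, hg⟩ => Order.succ_le_of_lt ?_
  rw [← rk_eq_rank hJ]
  exact h g hg

/-- The rank is monotone in the relation, and depends only on which functions lie below. -/
theorem rk_le_rk {H : Type u} {J K : Set (Set (Set H))} (hJK : J ⊆ K)
    (hK : WellFounded (ltIdeal.{u, v} H K)) {f g : Set H → Ordinal.{v}}
    (hfg : ∀ h, ltIdeal H J h f → ltIdeal H K h g) : rk H J f ≤ rk H K g := by
  have hJ : WellFounded (ltIdeal.{u, v} H J) := Subrelation.wf (fun h => hJK h) hK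
  induction f using hJ.induction generalizing g with
  | _ f ih =>
    exact rk_le hJ fun h hh =>
      (ih h hh fun _ hk => hJK hk).trans_lt (rk_lt_rk hK (hfg h hh))

/-- A lower bound for the ranks of `f` on countably many sets is a lower bound on their union. -/
theorem IsFineIdeal.le_rk_add_iUnion {H : Type u} {I : Set (Set (Set H))} (hI : IsFineIdeal H I)
    (α : Ordinal.{max u (v + 1)}) {f : Set H → Ordinal.{v}} {A : ℕ → Set (Set H)}
    (hA : ∀ n, A n ⊆ Pom H) (hα : ∀ n, A n ∈ I ∨ α ≤ rk H (add H I (A n)) f) :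
    (⋃ n, A n) ∈ I ∨ α ≤ rk H (add H I (⋃ n, A n)) f := by
  induction α using WellFoundedLT.induction generalizing f A with
  | _ α ih =>
    refine or_iff_not_imp_left.2 fun hU => le_of_forall_lt fun β hβ => ?_
    have hUP : (⋃ n, A n) ⊆ Pom H := Set.iUnion_subset hA
    have hg : ∀ n, ∃ g : Set H → Ordinal.{v}, {M ∈ A n | ¬ g M < f M} ∈ I ∧
        (A n ∈ I ∨ β ≤ rk H (add H I (A n)) g) := fun n => by
      by_cases hn : A n ∈ I
      · exact ⟨f, hI.1.subset_mem _ hn _ fun M hM => hM.1, .inl hn⟩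
      · by_contra hcon
        refine (((hα n).resolve_left hn).trans (rk_le (hI.wellFounded_add ⟨hA n, hn⟩)
          fun g hg => ?_)).not_gt hβ
        exact lt_of_not_ge fun h => hcon ⟨g, (ltIdeal_add_iff (hA n)).1 hg, .inr h⟩
    choose g hgf hgβ using hg
    let k : Set H → ℕ := fun M => sInf {n | M ∈ A n}
    let B : ℕ → Set (Set H) := fun n => {M ∈ A n | k M = n}
    have hBA : ∀ n, B n ⊆ A n := fun n M hM => hM.1
    have hBU : (⋃ n, B n) = ⋃ n, A n := by
      refine (Set.iUnion_mono hBA).antisymm fun M hM => ?_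
      rw [Set.mem_iUnion] at hM ⊢
      exact ⟨k M, Nat.sInf_mem (s := {n | M ∈ A n}) hM, rfl⟩
    let G : Set H → Ordinal.{v} := fun M => g (k M) M
    have hGf : ltIdeal H (add H I (⋃ n, A n)) G f := by
      rw [ltIdeal_add_iff hUP]
      refine hI.1.subset_mem _ (hI.2.1 _ hgf) _ fun M hM => ?_
      obtain ⟨hMU, hMG⟩ := hM
      rw [← hBU] at hMU
      obtain ⟨n, hMn, rfl⟩ := Set.mem_iUnion.1 hMU
      exact Set.mem_iUnion.2 ⟨k M, hMn, hMG⟩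
    have hGβ : ∀ n, B n ∈ I ∨ β ≤ rk H (add H I (B n)) G := fun n => by
      refine or_iff_not_imp_left.2 fun hBn => ?_
      have hBP := (hBA n).trans (hA n)
      refine ((hgβ n).resolve_left fun h => hBn (hI.1.subset_mem _ h _ (hBA n))).trans
        (rk_le_rk (hI.add_mono (hBA n)) (hI.wellFounded_add ⟨hBP, hBn⟩) fun h hh => ?_)
      rw [ltIdeal_add_iff (hA n)] at hh
      rw [ltIdeal_add_iff hBP]
      refine hI.1.subset_mem _ hh _ ?_
      rintro M ⟨⟨hMA, rfl⟩, hMh⟩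
      exact ⟨hMA, hMh⟩
    have hle := ih β hβ (fun n => (hBA n).trans (hA n)) hGβ
    rw [hBU] at hle
    exact (hle.resolve_left hU).trans_lt (rk_lt_rk (hI.wellFounded_add ⟨hUP, hU⟩) hGf)

/-- Lemma 3.7(i): for a fine ideal `I` and ordinal-valued `f`, the collection
`I[f, I] = I ∪ {A ∈ I⁺ : rk_{I+A}(f) > rk_I(f)}` is a fine ideal extending `I`. -/
theorem shelah_operator_fine {H : Type u} [Nonempty H] (I : Set (Set (Set H)))
    (hI : IsFineIdeal H I) (f : Set H → Ordinal.{v}) :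
    IsFineIdeal H (I ∪ {A | A ∈ pos H I ∧ rk H I f < rk H (add H I A) f}) ∧
      I ⊆ I ∪ {A | A ∈ pos H I ∧ rk H I f < rk H (add H I A) f} := by
  have hmem : ∀ A, A ∈ I ∪ {A | A ∈ pos H I ∧ rk H I f < rk H (add H I A) f} ↔
      A ⊆ Pom H ∧ (A ∈ I ∨ Order.succ (rk H I f) ≤ rk H (add H I A) f) := fun A => by
    rw [Order.succ_le_iff]
    constructor
    · rintro (h | ⟨h, hlt⟩)
      · exact ⟨hI.1.subset_pom A h, .inl h⟩
      · exact ⟨h.1, .inr hlt⟩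
    · rintro ⟨hA, h⟩
      by_cases hAI : A ∈ I
      · exact .inl hAI
      · exact .inr ⟨⟨hA, hAI⟩, h.resolve_left hAI⟩
  have hcomplete : IsComplete (I ∪ {A | A ∈ pos H I ∧ rk H I f < rk H (add H I A) f}) := by
    intro A hA
    simp only [hmem] at hA ⊢
    exact ⟨Set.iUnion_subset fun n => (hA n).1,
      hI.le_rk_add_iUnion _ (fun n => (hA n).1) fun n => (hA n).2⟩
  refine ⟨⟨⟨fun A hA => ((hmem A).1 hA).1, .inl hI.1.empty_mem, ?_, ?_, ?_⟩, hcomplete,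
    fun x => .inl (hI.2.2 x)⟩, Set.subset_union_left⟩
  · intro A hA B hBA
    rw [hmem] at hA ⊢
    refine ⟨hBA.trans hA.1, or_iff_not_imp_left.2 fun hB => ?_⟩
    refine (hA.2.resolve_left fun h => hB (hI.1.subset_mem _ h _ hBA)).trans ?_
    exact rk_le_rk (hI.add_mono hBA) (hI.wellFounded_add ⟨hBA.trans hA.1, hB⟩)
      fun h hh => hI.add_mono hBA hh
  · intro A hA B hB
    have hunion := hcomplete (fun n => if n = 0 then A else B) fun n => by
      split_ifs
      exacts [hA, hB]
    convert hunion using 1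
    ext M
    simp only [Set.mem_union, Set.mem_iUnion]
    constructor
    · rintro (h | h)
      exacts [⟨0, by simpa using h⟩, ⟨1, by simpa using h⟩]
    · rintro ⟨n, hn⟩
      split_ifs at hn
      exacts [.inl hn, .inr hn]
  · rintro (h | ⟨-, h⟩)
    · exact hI.1.proper h
    · rw [hI.add_pom] at h
      exact h.false

end Galvin
end

section
/- Fix a positive integer K, a regular Hausdorff topological space X with a point-countable basis 𝔅, and for each x ∈ X an enumeration ⟨U_{x,k} : k < ω⟩ of {U ∈ 𝔅 : x ∈ U}. Fix a colouring c assigning to every unordered pair of distinct elements of X a colour in {0,…,K−1}, a set H, a fine normal ideal I on P_{ω1}(H), a set A ∈ I⁺, and a function F : A → X. If (A, I) is a winning pair for c, then there is Y ⊆ X which is homeomorphic to ℚ and such that c takes at most 2 values on unordered pairs of distinct elements of Y, i.e. |c''[Y]²| ≤ 2. -/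
namespace Galvin

/-- `∃^I M ∈ A, φ(M)`: the set of `M ∈ A` with `φ(M)` is `(I+A)`-positive. -/
def eIdeal {H : Type u} (I : Set (Set (Set H))) (A : Set (Set H)) (φ : Set H → Prop) : Prop :=
  {M ∈ A | φ M} ∈ pos H (add H I A)

/-- `∀^I M ∈ A, φ(M)`: the set of `M ∈ A` with `φ(M)` is in the dual filter `(I+A)*`. -/
def aIdeal {H : Type u} (I : Set (Set (Set H))) (A : Set (Set H)) (φ : Set H → Prop) : Prop :=
  {M ∈ A | φ M} ∈ star H (add H I A)

/-- `(A, B)` is weakly `(i,j)`-saturated over `I`. -/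
def WeaklySat {H : Type u} {X : Type v} {K : ℕ} (c : Sym2 X → Fin K)
    (I : Set (Set (Set H))) (F : Set H → X) (A B : Set (Set H)) (i j : Fin K) : Prop :=
  eIdeal I A (fun M => eIdeal I B (fun N => F M ≠ F N ∧ c s(F M, F N) = i)) ∧
  eIdeal I B (fun N => eIdeal I A (fun M => F M ≠ F N ∧ c s(F M, F N) = j))

/-- `(A, B)` is `(i,j)`-saturated over `I`: every pair of `I`-positive subsets is weakly
`(i,j)`-saturated over `I`. -/
def Sat {H : Type u} {X : Type v} {K : ℕ} (c : Sym2 X → Fin K)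
    (I : Set (Set (Set H))) (F : Set H → X) (A B : Set (Set H)) (i j : Fin K) : Prop :=
  ∀ C, C ⊆ A → C ∈ pos H I → ∀ D, D ⊆ B → D ∈ pos H I → WeaklySat c I F C D i j

/-- `(A, B)` is `P`-unsaturated over `I`: for no `(i,j) ∈ P` is `(A,B)` weakly
`(i,j)`-saturated over `I`. -/
def Unsat {H : Type u} {X : Type v} {K : ℕ} (c : Sym2 X → Fin K)
    (I : Set (Set (Set H))) (F : Set H → X) (A B : Set (Set H))
    (P : Set (Fin K × Fin K)) : Prop :=
  ∀ p ∈ P, ¬ WeaklySat c I F A B p.1 p.2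

end Galvin
namespace Galvin

/-- `x` is an `(i,j)`-winner below `B` over `I` (relative to `F`, `c` and the chosen
neighbourhood enumerations `U`). -/
def IsWinner {H : Type u} {X : Type v} {K : ℕ} (c : Sym2 X → Fin K)
    (I : Set (Set (Set H))) (F : Set H → X) (U : X → ℕ → Set X)
    (B : Set (Set H)) (i j : Fin K) (x : X) : Prop :=
  (∃ M ∈ B, F M = x) ∧
  ∃ T : ℕ → Set (Set H),
    (∀ k, T k ⊆ B ∧ T k ∈ pos H I) ∧
    (∀ k, ∀ N ∈ T k, F N ≠ x ∧ c s(x, F N) = i) ∧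
    (∀ k l, k < l → Sat c I F (T l) (T k) i j) ∧
    (∀ k, ∀ N ∈ T k, F N ∈ U x k)

/-- `(A, I)` is an `(i,j)`-winning pair: below every `I`-positive `B ⊆ A` there is an
`(i,j)`-winner over `I`. -/
def IsWinningPairFor {H : Type u} {X : Type v} {K : ℕ} (c : Sym2 X → Fin K)
    (I : Set (Set (Set H))) (F : Set H → X) (U : X → ℕ → Set X)
    (A : Set (Set H)) (i j : Fin K) : Prop :=
  ∀ B, B ⊆ A → B ∈ pos H I → ∃ x : X, IsWinner c I F U B i j x

/-- `(A, I)` is a winning pair for `c`. -/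
def IsWinningPair {H : Type u} {X : Type v} {K : ℕ} (c : Sym2 X → Fin K)
    (I : Set (Set (Set H))) (F : Set H → X) (U : X → ℕ → Set X)
    (A : Set (Set H)) : Prop :=
  ∃ i j : Fin K, IsWinningPairFor c I F U A i j

end Galvin

namespace Galvin

/-- The set of colours taken by the pair-colouring `c` on unordered pairs of
distinct elements of `Y`, i.e. `c''[Y]²`. -/
def pairColours {X : Type v} {K : ℕ} (c : Sym2 X → Fin K) (Y : Set X) : Set (Fin K) :=
  {k | ∃ x ∈ Y, ∃ y ∈ Y, x ≠ y ∧ c s(x, y) = k}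

section Sierpinski

open Topology TopologicalSpace

variable {X : Type*} {Y : Type*} [TopologicalSpace X] [TopologicalSpace Y]

/-- A countable regular Hausdorff space has arbitrarily small clopen neighbourhoods. -/
theorem exists_isClopen_subset [Countable X] [T2Space X] [RegularSpace X] {x : X} {V : Set X}
    (hV : IsOpen V) (hx : x ∈ V) : ∃ W, IsClopen W ∧ x ∈ W ∧ W ⊆ V := by
  have h : Cardinal.mk X < Cardinal.continuum :=
    (Cardinal.mk_le_aleph0).trans_lt Cardinal.aleph0_lt_continuum
  obtain ⟨W, hW, hxW, hWV⟩ :=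
    (CompletelyRegularSpace.isTopologicalBasis_clopens_of_cardinalMk_lt_continuum h
      ).exists_subset_of_mem_open hx hV
  exact ⟨W, hW, hxW, hWV⟩

/-- Finite-information approximations to a homeomorphism between `X` and `Y`: matched partitions
of `X` and `Y` into clopen pieces, each piece labelled by a pair of points, one from each of the
two matched pieces. -/
structure Approx (X : Type*) (Y : Type*) [TopologicalSpace X] [TopologicalSpace Y] where
  left : X → X × Y
  right : Y → X × Y
  left_loc : IsLocallyConstant left
  right_loc : IsLocallyConstant right
  left_left : ∀ x, left (left x).1 = left x
  right_left : ∀ x, right (left x).2 = left x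
  left_right : ∀ y, left (right y).1 = right y
  right_right : ∀ y, right (right y).2 = right y

namespace Approx

/-- `c ≤ d` when `d` keeps the labels of `c` and refines its partitions. -/
instance : Preorder (Approx X Y) where
  le c d := (∀ x, d.left (c.left x).1 = c.left x) ∧
    ∀ x y, d.left x = d.right y → c.left x = c.right y
  le_refl c := ⟨c.left_left, fun _ _ h => h⟩
  le_trans c d e hcd hde := by
    refine ⟨fun x => ?_, fun x y h => hcd.2 x y (hde.2 x y h)⟩
    have := hde.1 (c.left x).1
    rwa [hcd.1] at this

theorem right_eq_of_left_eq (c : Approx X Y) {s : X × Y} (h : c.left s.1 = s) :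
    c.right s.2 = s := by
  have := c.right_left s.1
  rwa [h] at this

theorem left_eq_of_right_eq (c : Approx X Y) {s : X × Y} (h : c.right s.2 = s) :
    c.left s.1 = s := by
  have := c.left_right s.2
  rwa [h] at this

theorem left_eq_of_le {c d : Approx X Y} (h : c ≤ d) {s : X × Y} (hs : c.left s.1 = s) :
    d.left s.1 = s := by
  have := h.1 s.1
  rwa [hs] at this

/-- The approximation with the roles of the two spaces exchanged. -/
def swap (c : Approx X Y) : Approx Y X where
  left y := (c.right y).swap
  right x := (c.left x).swap
  left_loc := c.right_loc.comp Prod.swap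
  right_loc := c.left_loc.comp Prod.swap
  left_left y := by simp [c.right_right]
  right_left y := by simp [c.left_right]
  left_right x := by simp [c.right_left]
  right_right x := by simp [c.left_left]

theorem swap_le_swap {c d : Approx X Y} (h : c ≤ d) : c.swap ≤ d.swap := by
  refine ⟨fun y => ?_, fun y x e => ?_⟩
  · simp only [swap, Prod.fst_swap, Prod.swap_inj]
    exact d.right_eq_of_left_eq (left_eq_of_le h (c.left_right y))
  · simp only [swap, Prod.swap_inj] at e ⊢
    exact (h.2 x y e.symm).symm

open Classical in
theorem isLocallyConstant_ite {Z : Type*} {p : X → Z} (hp : IsLocallyConstant p) {V : Set X}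
    (hV : IsClopen V) (s t : Z) :
    IsLocallyConstant fun x => if x ∈ V ∧ p x = s then t else p x := by
  rw [IsLocallyConstant.iff_eventually_eq]
  intro x
  have hVx : ∀ᶠ x' in 𝓝 x, x' ∈ V ↔ x ∈ V := by
    by_cases hx : x ∈ V
    · filter_upwards [hV.isOpen.mem_nhds hx] with x' hx'
      simp [hx, hx']
    · filter_upwards [hV.compl.isOpen.mem_nhds hx] with x' hx'
      simpa [hx] using hx'
  filter_upwards [hp.eventually_eq x, hVx] with x' h₁ h₂
  simp only [h₁, h₂]

open Classical in
/-- A matched pair of pieces can be split along clopen sets. -/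
theorem exists_split (c : Approx X Y) {s t : X × Y} (hs : c.left s.1 = s)
    (htl : c.left t.1 = s) (htr : c.right t.2 = s) {V : Set X} {W : Set Y} (hV : IsClopen V)
    (hW : IsClopen W) (htV : t.1 ∈ V) (hsV : s.1 ∉ V) (htW : t.2 ∈ W) (hsW : s.2 ∉ W) :
    ∃ d, c ≤ d ∧ d.left t.1 = t ∧ ∀ x, d.left x = s → x ∉ V := by
  have hst : s ≠ t := by
    rintro rfl
    exact hsV htV
  have hnl : ∀ r : X × Y, ¬ (r.1 ∈ V ∧ r = s) := by
    rintro _ ⟨h, rfl⟩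
    exact hsV h
  have hnr : ∀ r : X × Y, ¬ (r.2 ∈ W ∧ r = s) := by
    rintro _ ⟨h, rfl⟩
    exact hsW h
  refine ⟨{ left := fun x => if x ∈ V ∧ c.left x = s then t else c.left x
            right := fun y => if y ∈ W ∧ c.right y = s then t else c.right y
            left_loc := by convert isLocallyConstant_ite c.left_loc hV s t
            right_loc := by convert isLocallyConstant_ite c.right_loc hW s t
            left_left := fun x => ?_
            right_left := fun x => ?_
            left_right := fun y => ?_
            right_right := fun y => ?_ }, ⟨fun x => ?_, fun x y => ?_⟩, ?_, fun x => ?_⟩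
  · by_cases h : x ∈ V ∧ c.left x = s
    · simp [h, htV, htl]
    · simp only [h, if_false, c.left_left, hnl]
  · by_cases h : x ∈ V ∧ c.left x = s
    · simp [h, htW, htr]
    · simp only [h, if_false, c.right_left, hnr]
  · by_cases h : y ∈ W ∧ c.right y = s
    · simp [h, htV, htl]
    · simp only [h, if_false, c.left_right, hnl]
  · by_cases h : y ∈ W ∧ c.right y = s
    · simp [h, htW, htr]
    · simp only [h, if_false, c.right_right, hnr]
  · simp only [c.left_left, hnl, if_false]
  · dsimp only
    split_ifs with h₁ h₂ h₂
    · exact fun _ => h₁.2.trans h₂.2.symm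
    · intro h
      have h' := c.left_right y
      rw [← h, htl] at h'
      exact h₁.2.trans (h'.trans h)
    · intro h
      have h' := c.right_left x
      rw [h, htr] at h'
      exact h.trans (h'.symm.trans h₂.2.symm)
    · exact id
  · simp [htV, htl]
  · dsimp only
    split_ifs with h
    · exact fun h' => absurd h'.symm hst
    · exact fun h' hx => h ⟨hx, h'⟩

theorem exists_ne_right [PerfectSpace Y] (c : Approx X Y) {s : X × Y} (hs : c.right s.2 = s) :
    ∃ y, c.right y = s ∧ y ≠ s.2 := by
  have h := c.right_loc.eventually_eq s.2
  obtain ⟨y, hy, hne⟩ :=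
    ((h.filter_mono nhdsWithin_le_nhds).and (self_mem_nhdsWithin (s := {s.2}ᶜ))).exists
  exact ⟨y, hy.trans hs, hne⟩

section

variable [Countable X] [T2Space X] [RegularSpace X] [Countable Y] [T2Space Y] [RegularSpace Y]

theorem exists_left_fst [PerfectSpace Y] (c : Approx X Y) (x : X) :
    ∃ d, c ≤ d ∧ (d.left x).1 = x := by
  by_cases hx : (c.left x).1 = x
  · exact ⟨c, le_rfl, hx⟩
  obtain ⟨y, hy, hne⟩ := c.exists_ne_right (c.right_left x)
  obtain ⟨V, hV, hxV, hVs⟩ := exists_isClopen_subset (isOpen_compl_singleton (x := (c.left x).1))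
    (Ne.symm hx)
  obtain ⟨W, hW, hyW, hWs⟩ := exists_isClopen_subset (isOpen_compl_singleton (x := (c.left x).2))
    hne
  obtain ⟨d, hd, hdx, -⟩ := c.exists_split (s := c.left x) (t := (x, y)) (c.left_left x) rfl hy hV
    hW hxV (fun h => hVs h rfl) hyW (fun h => hWs h rfl)
  exact ⟨d, hd, by rw [hdx]⟩

theorem exists_left_subset [PerfectSpace Y] (c : Approx X Y) {x : X} {V : Set X}
    (hV : IsOpen V) (hx : x ∈ V) :
    ∃ d, c ≤ d ∧ (d.left x).1 = x ∧ ∀ x', d.left x' = d.left x → x' ∈ V := by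
  obtain ⟨d, hcd, hdx⟩ := c.exists_left_fst x
  obtain ⟨V', hV', hxV', hVV'⟩ := exists_isClopen_subset hV hx
  by_cases h : ∀ x', d.left x' = d.left x → x' ∈ V'
  · exact ⟨d, hcd, hdx, fun x' hx' => hVV' (h x' hx')⟩
  push Not at h
  obtain ⟨x₀, hx₀, hx₀V⟩ := h
  obtain ⟨y, hy, hne⟩ := d.exists_ne_right (d.right_left x)
  obtain ⟨W, hW, hyW, hWs⟩ := exists_isClopen_subset (isOpen_compl_singleton (x := (d.left x).2))
    hne
  obtain ⟨e, hde, -, he⟩ := d.exists_split (s := d.left x) (t := (x₀, y)) (d.left_left x) hx₀ hy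
    hV'.compl hW hx₀V (by simpa [hdx] using hxV') hyW (fun h => hWs h rfl)
  have hex : e.left x = d.left x := by
    have := hde.1 x
    rwa [hdx] at this
  refine ⟨e, hcd.trans hde, hex ▸ hdx, fun x' hx' => hVV' ?_⟩
  simpa using he x' (hx'.trans hex)

theorem exists_right_subset [PerfectSpace X] (c : Approx X Y) {y : Y} {W : Set Y}
    (hW : IsOpen W) (hy : y ∈ W) :
    ∃ d, c ≤ d ∧ (d.right y).2 = y ∧ ∀ y', d.right y' = d.right y → y' ∈ W := by
  obtain ⟨d, hd, hdy, h⟩ := c.swap.exists_left_subset hW hy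
  exact ⟨d.swap, swap_le_swap hd, hdy, fun y' hy' => h y' (Prod.swap_injective hy')⟩

end

end Approx

/-- Sierpiński's theorem: any two nonempty countable second countable regular Hausdorff spaces
without isolated points are homeomorphic. -/
theorem nonempty_homeomorph_of_countable_perfect
    [Countable X] [T2Space X] [RegularSpace X] [PerfectSpace X] [SecondCountableTopology X]
    [Nonempty X] [Countable Y] [T2Space Y] [RegularSpace Y] [PerfectSpace Y]
    [SecondCountableTopology Y] [Nonempty Y] : Nonempty (X ≃ₜ Y) := by
  let ι := {a : X × countableBasis X // a.1 ∈ a.2.1} ⊕ {b : Y × countableBasis Y // b.1 ∈ b.2.1}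
  have : Countable (countableBasis X) := countable_countableBasis X
  have : Countable (countableBasis Y) := countable_countableBasis Y
  let _ : Encodable ι := Encodable.ofCountable ι
  let 𝒟 : ι → Order.Cofinal (Approx X Y) := Sum.elim
    (fun a => ⟨{d | (d.left a.1.1).1 = a.1.1 ∧ ∀ x', d.left x' = d.left a.1.1 → x' ∈ a.1.2.1},
      fun c => by
        obtain ⟨d, hcd, h⟩ := c.exists_left_subset (isOpen_of_mem_countableBasis a.1.2.2) a.2
        exact ⟨d, h, hcd⟩⟩)
    (fun b => ⟨{d | (d.right b.1.1).2 = b.1.1 ∧ ∀ y', d.right y' = d.right b.1.1 → y' ∈ b.1.2.1},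
      fun c => by
        obtain ⟨d, hcd, h⟩ := c.exists_right_subset (isOpen_of_mem_countableBasis b.1.2.2) b.2
        exact ⟨d, h, hcd⟩⟩)
  obtain ⟨x₀⟩ := ‹Nonempty X›
  obtain ⟨y₀⟩ := ‹Nonempty Y›
  let c₀ : Approx X Y :=
    { left := fun _ => (x₀, y₀)
      right := fun _ => (x₀, y₀)
      left_loc := IsLocallyConstant.const _
      right_loc := IsLocallyConstant.const _
      left_left := fun _ => rfl
      right_left := fun _ => rfl
      left_right := fun _ => rfl
      right_right := fun _ => rfl }
  let G := Order.idealOfCofinals c₀ 𝒟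
  have hX : ∀ x : X, ∀ V ∈ 𝓝 x, ∃ d ∈ G, (d.left x).1 = x ∧
      ∀ x', d.left x' = d.left x → x' ∈ V := by
    intro x V hV
    obtain ⟨V', hV', hxV', hVV'⟩ := (isBasis_countableBasis X).mem_nhds_iff.1 hV
    obtain ⟨d, hd, hdG⟩ := Order.cofinal_meets_idealOfCofinals c₀ 𝒟 (Sum.inl ⟨(x, ⟨V', hV'⟩), hxV'⟩)
    exact ⟨d, hdG, hd.1, fun x' hx' => hVV' (hd.2 x' hx')⟩
  have hY : ∀ y : Y, ∀ W ∈ 𝓝 y, ∃ d ∈ G, (d.right y).2 = y ∧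
      ∀ y', d.right y' = d.right y → y' ∈ W := by
    intro y W hW
    obtain ⟨W', hW', hyW', hWW'⟩ := (isBasis_countableBasis Y).mem_nhds_iff.1 hW
    obtain ⟨d, hd, hdG⟩ := Order.cofinal_meets_idealOfCofinals c₀ 𝒟 (Sum.inr ⟨(y, ⟨W', hW'⟩), hyW'⟩)
    exact ⟨d, hdG, hd.1, fun y' hy' => hWW' (hd.2 y' hy')⟩
  let S : X → Y → Prop := fun x y => ∃ d ∈ G, d.left x = (x, y)
  have hSl : ∀ {x y d}, d ∈ G → d.right y = (x, y) → S x y := fun hd h =>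
    ⟨_, hd, Approx.left_eq_of_right_eq _ (s := (_, _)) h⟩
  have key : ∀ {d}, d ∈ G → ∀ {x y}, S x y → d.left x = d.right y := by
    rintro d hd x y ⟨e, he, hxy⟩
    obtain ⟨f, -, hdf, hef⟩ := G.directed d hd e he
    have hf := Approx.left_eq_of_le hef (s := (x, y)) hxy
    exact hdf.2 _ _ (hf.trans (f.right_eq_of_left_eq (s := (x, y)) hf).symm)
  have exY : ∀ x, ∃ y, S x y := fun x => by
    obtain ⟨d, hd, h, -⟩ := hX x _ Filter.univ_mem
    exact ⟨(d.left x).2, d, hd, Prod.ext h rfl⟩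
  have exX : ∀ y, ∃ x, S x y := fun y => by
    obtain ⟨d, hd, h, -⟩ := hY y _ Filter.univ_mem
    exact ⟨(d.right y).1, hSl hd (Prod.ext rfl h)⟩
  choose f hf using exY
  choose g hg using exX
  have uY : ∀ {x y y'}, S x y → S x y' → y = y' := by
    intro x y y' h h'
    by_contra hne
    obtain ⟨d, hd, hd₁, hd₂⟩ := hY y {y'}ᶜ (isOpen_compl_singleton.mem_nhds hne)
    exact hd₂ y' ((key hd h').symm.trans (key hd h)) rfl
  have uX : ∀ {x x' y}, S x y → S x' y → x = x' := by
    intro x x' y h h'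
    by_contra hne
    obtain ⟨d, hd, hd₁, hd₂⟩ := hX x {x'}ᶜ (isOpen_compl_singleton.mem_nhds hne)
    exact hd₂ x' ((key hd h').trans (key hd h).symm) rfl
  refine ⟨{ toFun := f
            invFun := g
            left_inv := fun x => uX (hg (f x)) (hf x)
            right_inv := fun y => uY (hf (g y)) (hg y)
            continuous_toFun := continuous_iff_continuousAt.2 fun x W hW => ?_
            continuous_invFun := continuous_iff_continuousAt.2 fun y V hV => ?_ }⟩
  · obtain ⟨d, hd, -, h⟩ := hY (f x) W hW
    refine Filter.mem_map.2 ?_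
    filter_upwards [d.left_loc.eventually_eq x] with x' hx'
    exact h _ (by rw [← key hd (hf x'), hx', key hd (hf x)])
  · obtain ⟨d, hd, -, h⟩ := hX (g y) V hV
    refine Filter.mem_map.2 ?_
    filter_upwards [d.right_loc.eventually_eq y] with y' hy'
    exact h _ (by rw [key hd (hg y'), hy', key hd (hg y)])

end Sierpinski

section Combinatorics

variable {H : Type u} {X : Type v} {K : ℕ} {c : Sym2 X → Fin K} {I : Set (Set (Set H))}
  {F : Set H → X} {i j : Fin K}

theorem pos_mono (hI : IsIdeal H I) {A B : Set (Set H)} (hA : A ∈ pos H I) (hAB : A ⊆ B)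
    (hB : B ⊆ Pom H) : B ∈ pos H I :=
  ⟨hB, fun h => hA.2 (hI.subset_mem B h A hAB)⟩

theorem eIdeal_iff {A : Set (Set H)} (hA : A ⊆ Pom H) {φ : Set H → Prop} :
    eIdeal I A φ ↔ {M ∈ A | φ M} ∈ pos H I := by
  have hsub : {M ∈ A | φ M} ⊆ Pom H := fun M hM => hA hM.1
  have hinter : {M ∈ A | φ M} ∩ A = {M ∈ A | φ M} := Set.inter_eq_left.2 fun M hM => hM.1
  simp only [eIdeal, pos, add, Set.mem_ofPred_eq, hinter, hsub, true_and]

/-- Positively many elements of any positive `C ⊆ A` see positively many elements of any positive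
`D ⊆ B` in one of the colours `i`, `j`. -/
def Compat (c : Sym2 X → Fin K) (I : Set (Set (Set H))) (F : Set H → X) (i j : Fin K)
    (A B : Set (Set H)) : Prop :=
  ∀ C, C ⊆ A → C ∈ pos H I → ∀ D, D ⊆ B → D ∈ pos H I →
    ∃ M ∈ C, {N ∈ D | F M ≠ F N ∧ (c s(F M, F N) = i ∨ c s(F M, F N) = j)} ∈ pos H I

theorem Compat.mono {A B A' B' : Set (Set H)} (h : Compat c I F i j A B) (hA : A' ⊆ A)
    (hB : B' ⊆ B) : Compat c I F i j A' B' :=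
  fun C hC hCp D hD hDp => h C (hC.trans hA) hCp D (hD.trans hB) hDp

theorem exists_mem_of_pos (hI : IsIdeal H I) {A : Set (Set H)} (hA : A ∈ pos H I) :
    A.Nonempty := by
  rw [Set.nonempty_iff_ne_empty]
  rintro rfl
  exact hA.2 hI.empty_mem

theorem Sat.compat (hI : IsIdeal H I) {A B : Set (Set H)} (h : Sat c I F A B i j) :
    Compat c I F i j A B := by
  intro C hC hCp D hD hDp
  have h₁ := (eIdeal_iff hCp.1).1 (h C hC hCp D hD hDp).1
  obtain ⟨M, hM, hMD⟩ := exists_mem_of_pos hI h₁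
  exact ⟨M, hM, pos_mono hI ((eIdeal_iff hDp.1).1 hMD) (fun N hN => ⟨hN.1, hN.2.1, Or.inl hN.2.2⟩)
    fun N hN => hDp.1 hN.1⟩

theorem Sat.compat_symm (hI : IsIdeal H I) {A B : Set (Set H)} (h : Sat c I F A B i j) :
    Compat c I F i j B A := by
  intro D hD hDp C hC hCp
  have h₁ := (eIdeal_iff hDp.1).1 (h C hC hCp D hD hDp).2
  obtain ⟨N, hN, hNC⟩ := exists_mem_of_pos hI h₁
  refine ⟨N, hN, pos_mono hI ((eIdeal_iff hCp.1).1 hNC) (fun M hM => ⟨hM.1, hM.2.1.symm, ?_⟩)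
    fun M hM => hCp.1 hM.1⟩
  rw [Sym2.eq_swap]
  exact Or.inr hM.2.2

/-- Almost every element of `C` is compatible with every member of a countable family. -/
theorem Compat.pos_forall (hI : IsIdeal H I) (hIc : IsComplete I) {C : Set (Set H)}
    (hC : C ∈ pos H I) {P : ℕ → Set (Set H)} {L : ℕ → Prop} (hP : ∀ q, L q → P q ∈ pos H I)
    (h : ∀ q, L q → Compat c I F i j C (P q)) :
    {M ∈ C | ∀ q, L q →
      {N ∈ P q | F M ≠ F N ∧ (c s(F M, F N) = i ∨ c s(F M, F N) = j)} ∈ pos H I} ∈ pos H I := by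
  set G := {M ∈ C | ∀ q, L q →
      {N ∈ P q | F M ≠ F N ∧ (c s(F M, F N) = i ∨ c s(F M, F N) = j)} ∈ pos H I} with hG
  let E : ℕ → Set (Set H) := fun q => {M ∈ C | L q ∧
      {N ∈ P q | F M ≠ F N ∧ (c s(F M, F N) = i ∨ c s(F M, F N) = j)} ∉ pos H I}
  have hE : ∀ q, E q ∈ I := by
    intro q
    by_contra hq
    have hEp : E q ∈ pos H I := ⟨fun M hM => hC.1 hM.1, hq⟩
    obtain ⟨M, hM⟩ := exists_mem_of_pos hI hEp
    have hL : L q := hM.2.1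
    obtain ⟨M', hM', h'⟩ := h q hL (E q) (fun M hM => hM.1) hEp (P q) subset_rfl (hP q hL)
    exact hM'.2.2 h'
  refine ⟨fun M hM => hC.1 hM.1, fun hGI => hC.2 ?_⟩
  refine hI.subset_mem _ (hI.union_mem _ hGI _ (hIc E hE)) _ fun M hM => ?_
  by_cases hMG : M ∈ G
  · exact Or.inl hMG
  · right
    simp only [hG, Set.mem_ofPred_eq, hM, true_and, not_forall] at hMG
    obtain ⟨q, hL, hq⟩ := hMG
    exact Set.mem_iUnion.2 ⟨q, hM, hL, hq⟩

/-- The codes `q` of pairs `(m, k)` such that the `m`-th point has been chosen by stage `n`, but no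
point has yet been chosen from its `k`-th positive set. -/
def Live (n q : ℕ) : Prop := n ≤ q ∧ q.unpair.1 ≤ n

/-- The positive sets still available at stage `n` are positive subsets of `A` and pairwise
compatible. -/
def Invariant (c : Sym2 X → Fin K) (I : Set (Set (Set H))) (F : Set H → X) (i j : Fin K)
    (A : Set (Set H)) (n : ℕ) (P : ℕ → Set (Set H)) : Prop :=
  (∀ q, Live n q → P q ⊆ A ∧ P q ∈ pos H I) ∧
    ∀ p q, Live n p → Live n q → p ≠ q → Compat c I F i j (P p) (P q)

/-- The transition from stage `n` to stage `n + 1`: the point `x` is chosen from `P n`, new positive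
sets inside `P n` converge to it, and all others shrink. -/
def Step (c : Sym2 X → Fin K) (F : Set H → X) (U : X → ℕ → Set X) (i j : Fin K)
    (n : ℕ) (P : ℕ → Set (Set H)) (x : X) (P' : ℕ → Set (Set H)) : Prop :=
  (∃ M ∈ P n, F M = x) ∧
  (∀ q, Live (n + 1) q → ∀ N ∈ P' q, x ≠ F N ∧ (c s(x, F N) = i ∨ c s(x, F N) = j)) ∧
  (∀ q, Live (n + 1) q → q.unpair.1 ≤ n → P' q ⊆ P q) ∧
  ∀ q, q.unpair.1 = n + 1 → P' q ⊆ P n ∧ ∀ N ∈ P' q, F N ∈ U x q.unpair.2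

theorem live_self (n : ℕ) : Live n n := ⟨le_rfl, Nat.unpair_left_le n⟩

theorem exists_step (hI : IsIdeal H I) (hIc : IsComplete I) {U : X → ℕ → Set X}
    {A : Set (Set H)} (hwin : IsWinningPairFor c I F U A i j) {n : ℕ} {P : ℕ → Set (Set H)}
    (hP : Invariant c I F i j A n P) :
    ∃ x P', Invariant c I F i j A (n + 1) P' ∧ Step c F U i j n P x P' := by
  have hn := hP.1 n (live_self n)
  have hGp := Compat.pos_forall (c := c) (F := F) (i := i) (j := j) hI hIc hn.2 (P := P)
    (L := fun q => Live n q ∧ n ≠ q) (fun q hq => (hP.1 q hq.1).2)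
    (fun q hq => hP.2 n q (live_self n) hq.1 hq.2)
  obtain ⟨x, ⟨M, hM, rfl⟩, T, hT, hTx, hTs, hTU⟩ := hwin _ (fun M hM => hn.1 hM.1) hGp
  have hTn : ∀ k, T k ⊆ P n := fun k N hN => ((hT k).1 hN).1
  have hTc : ∀ k l, k ≠ l → Compat c I F i j (T k) (T l) := fun k l hkl => by
    rcases lt_or_gt_of_ne hkl with h | h
    · exact (hTs k l h).compat_symm hI
    · exact (hTs l k h).compat hI
  let P' : ℕ → Set (Set H) := fun q => if q.unpair.1 = n + 1 then T q.unpair.2 else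
    {N ∈ P q | F M ≠ F N ∧ (c s(F M, F N) = i ∨ c s(F M, F N) = j)}
  have hnew : ∀ q, q.unpair.1 = n + 1 → P' q = T q.unpair.2 := fun q hq => if_pos hq
  have hold : ∀ q, q.unpair.1 ≠ n + 1 →
      P' q = {N ∈ P q | F M ≠ F N ∧ (c s(F M, F N) = i ∨ c s(F M, F N) = j)} :=
    fun q hq => if_neg hq
  have hlive : ∀ q, Live (n + 1) q → q.unpair.1 ≠ n + 1 → Live n q ∧ n ≠ q := by
    rintro q ⟨h₁, h₂⟩ h
    exact ⟨⟨by omega, by omega⟩, by omega⟩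
  have holdP : ∀ q, q.unpair.1 ≠ n + 1 → P' q ⊆ P q := fun q hq => by
    rw [hold q hq]
    exact fun N hN => hN.1
  refine ⟨F M, P', ⟨fun q hq => ?_, fun p q hp hq hpq => ?_⟩, ⟨M, hM.1, rfl⟩, fun q hq N hN => ?_,
    fun q hq hqn => holdP q (by omega), fun q hq => ?_⟩
  · by_cases h : q.unpair.1 = n + 1
    · rw [hnew q h]
      exact ⟨(hTn _).trans hn.1, (hT _).2⟩
    · refine ⟨(holdP q h).trans (hP.1 q (hlive q hq h).1).1, ?_⟩
      rw [hold q h]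
      exact hM.2 q (hlive q hq h)
  · by_cases h : p.unpair.1 = n + 1 <;> by_cases h' : q.unpair.1 = n + 1
    · rw [hnew p h, hnew q h']
      refine hTc _ _ fun e => hpq ?_
      rw [← Nat.pair_unpair p, ← Nat.pair_unpair q, h, h', e]
    · obtain ⟨hl, hne⟩ := hlive q hq h'
      refine (hP.2 n q (live_self n) hl hne).mono ?_ (holdP q h')
      rw [hnew p h]
      exact hTn _
    · obtain ⟨hl, hne⟩ := hlive p hp h
      refine (hP.2 p n hl (live_self n) hne.symm).mono (holdP p h) ?_
      rw [hnew q h']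
      exact hTn _
    · exact (hP.2 p q (hlive p hp h).1 (hlive q hq h').1 hpq).mono (holdP p h) (holdP q h')
  · by_cases h : q.unpair.1 = n + 1
    · rw [hnew q h] at hN
      exact ⟨(hTx _ N hN).1.symm, Or.inl (hTx _ N hN).2⟩
    · rw [hold q h] at hN
      exact hN.2
  · rw [hnew q hq]
    exact ⟨hTn _, hTU _⟩

/-- The combinatorial core: a sequence of distinct points using two colours in which every point is
a limit of others. -/
theorem exists_seq (hI : IsIdeal H I) (hIc : IsComplete I) {U : X → ℕ → Set X}
    {A : Set (Set H)} (hA : A ∈ pos H I) (hwin : IsWinningPairFor c I F U A i j) :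
    ∃ x : ℕ → X, (∀ m n, m < n → x m ≠ x n ∧ (c s(x m, x n) = i ∨ c s(x m, x n) = j)) ∧
      ∀ m k, ∃ n, m < n ∧ x n ∈ U (x m) k := by
  obtain ⟨x₀, -, T, hT, hTx, hTs, hTU⟩ := hwin A subset_rfl hA
  have hinj : ∀ p q : ℕ, Live 0 p → Live 0 q → p ≠ q → p.unpair.2 ≠ q.unpair.2 := by
    rintro p q ⟨-, hp⟩ ⟨-, hq⟩ hpq e
    refine hpq ?_
    rw [← Nat.pair_unpair p, ← Nat.pair_unpair q, Nat.le_zero.1 hp, Nat.le_zero.1 hq, e]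
  have h₀ : Invariant c I F i j A 0 fun q => T q.unpair.2 := by
    refine ⟨fun q _ => hT _, fun p q hp hq hpq => ?_⟩
    rcases lt_or_gt_of_ne (hinj p q hp hq hpq) with h | h
    · exact (hTs _ _ h).compat_symm hI
    · exact (hTs _ _ h).compat hI
  choose nx nP hinv hstep using fun (n : ℕ) (σ : {P // Invariant c I F i j A n P}) =>
    exists_step hI hIc hwin σ.2
  let σ : (n : ℕ) → {P // Invariant c I F i j A n P} :=
    fun n => Nat.rec ⟨_, h₀⟩ (fun n s => ⟨nP n s, hinv n s⟩) n
  let x : ℕ → X := fun n => Nat.casesOn n x₀ fun n => nx n (σ n)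
  have hst : ∀ n, Step c F U i j n (σ n).1 (x (n + 1)) (σ (n + 1)).1 := fun n => hstep n (σ n)
  have hcol : ∀ n q, Live n q → ∀ N ∈ (σ n).1 q, ∀ m ≤ n,
      x m ≠ F N ∧ (c s(x m, F N) = i ∨ c s(x m, F N) = j) := by
    intro n
    induction n with
    | zero =>
      intro q _ N hN m hm
      obtain rfl := Nat.le_zero.1 hm
      exact ⟨(hTx _ N hN).1.symm, Or.inl (hTx _ N hN).2⟩
    | succ n ih =>
      intro q hq N hN m hm
      rcases Nat.lt_or_ge n m with h | h
      · obtain rfl : m = n + 1 := by omega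
        exact (hst n).2.1 q hq N hN
      · by_cases hqn : q.unpair.1 = n + 1
        · exact ih n (live_self n) N (((hst n).2.2.2 q hqn).1 hN) m h
        · have hq' : q.unpair.1 ≤ n := by
            have := hq.2
            omega
          exact ih q ⟨by have := hq.1; omega, hq'⟩ N ((hst n).2.2.1 q hq hq' hN) m h
  have hnhd : ∀ n q, Live n q → ∀ N ∈ (σ n).1 q, F N ∈ U (x q.unpair.1) q.unpair.2 := by
    intro n
    induction n with
    | zero =>
      intro q hq N hN
      rw [Nat.le_zero.1 hq.2]
      exact hTU _ N hN
    | succ n ih =>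
      intro q hq N hN
      by_cases hqn : q.unpair.1 = n + 1
      · rw [hqn]
        exact ((hst n).2.2.2 q hqn).2 N hN
      · have hq' : q.unpair.1 ≤ n := by
          have := hq.2
          omega
        exact ih q ⟨by have := hq.1; omega, hq'⟩ N ((hst n).2.2.1 q hq hq' hN)
  refine ⟨x, fun m n hmn => ?_, fun m k => ?_⟩
  · obtain ⟨n, rfl⟩ : ∃ l, n = l + 1 := ⟨n - 1, by omega⟩
    obtain ⟨M, hM, hMx⟩ := (hst n).1
    rw [← hMx]
    exact hcol n n (live_self n) M hM m (by omega)
  · obtain ⟨M, hM, hMx⟩ := (hst (Nat.pair m k)).1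
    refine ⟨Nat.pair m k + 1, Nat.lt_succ_of_le (Nat.left_le_pair m k), ?_⟩
    rw [← hMx]
    simpa using hnhd _ _ (live_self _) M hM

end Combinatorics

open Topology TopologicalSpace in
/-- A countable subset of a space with a point-countable basis is second countable. -/
theorem secondCountableTopology_of_pointCountable {X : Type*} [TopologicalSpace X]
    {𝔅 : Set (Set X)} (h𝔅 : IsTopologicalBasis 𝔅) (hpc : ∀ x : X, {V ∈ 𝔅 | x ∈ V}.Countable)
    {Y : Set X} (hY : Y.Countable) : SecondCountableTopology Y := by
  refine (isTopologicalBasis_subtype h𝔅 (· ∈ Y)).secondCountableTopology ?_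
  refine (((hY.biUnion fun y _ => hpc y).image (Set.preimage (Subtype.val (p := (· ∈ Y)))
    )).union (Set.countable_singleton ∅)).mono ?_
  rintro _ ⟨V, hV, rfl⟩
  rcases Set.eq_empty_or_nonempty (Subtype.val (p := (· ∈ Y)) ⁻¹' V) with h | ⟨y, hy⟩
  · exact Or.inr h
  · exact Or.inl ⟨V, Set.mem_biUnion y.2 ⟨hV, hy⟩, rfl⟩

/-- Theorem 5.8 (the Raghavan–Todorčević construction): given a regular Hausdorff space `X`
with a point-countable basis `𝔅` and enumerations `U x` of the basic neighbourhoods of each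
point `x`, a colouring `c` into `K` colours, a fine normal ideal `I` on `P_{ω₁}(H)`,
`A ∈ I⁺`, and `F : A → X`, if `(A, I)` is a winning pair for `c` then there is `Y ⊆ X`
homeomorphic to `ℚ` with `|c''[Y]²| ≤ 2`. -/
theorem raghavan_todorcevic_construction {H : Type u} {X : Type v} [TopologicalSpace X]
    [T2Space X] [RegularSpace X]
    (𝔅 : Set (Set X)) (h𝔅 : TopologicalSpace.IsTopologicalBasis 𝔅)
    (hpc : ∀ x : X, {V ∈ 𝔅 | x ∈ V}.Countable)
    (U : X → ℕ → Set X) (hU : ∀ x : X, Set.range (U x) = {V ∈ 𝔅 | x ∈ V})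
    (K : ℕ) (hK : 0 < K) (c : Sym2 X → Fin K)
    (I : Set (Set (Set H))) (hI : IsFineIdeal H I) (hIn : IsNormal H I)
    (A : Set (Set H)) (hA : A ∈ pos H I) (F : Set H → X)
    (hwin : IsWinningPair c I F U A) :
    ∃ Y : Set X, Nonempty (↥Y ≃ₜ ℚ) ∧ (pairColours c Y).ncard ≤ 2 := by
  obtain ⟨i, j, hwin⟩ := hwin
  obtain ⟨x, hx, hlim⟩ := exists_seq hI.1 hI.2.1 hA hwin
  refine ⟨Set.range x, ?_, ?_⟩
  · have := secondCountableTopology_of_pointCountable h𝔅 hpc (Set.countable_range x)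
    have : Countable (Set.range x) := (Set.countable_range x).to_subtype
    have : PerfectSpace (Set.range x) := by
      rw [perfectSpace_iff_forall_not_isolated]
      rintro ⟨_, m, rfl⟩
      rw [← mem_closure_iff_nhdsWithin_neBot, mem_closure_iff_nhds]
      intro V hV
      obtain ⟨W, hW, hWV⟩ := mem_nhds_subtype _ _ _ |>.1 hV
      obtain ⟨B, hB, hxB, hBW⟩ := h𝔅.mem_nhds_iff.1 hW
      obtain ⟨k, rfl⟩ : B ∈ Set.range (U (x m)) := hU (x m) ▸ ⟨hB, hxB⟩
      obtain ⟨n, hmn, hn⟩ := hlim m k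
      exact ⟨⟨x n, n, rfl⟩, hWV (hBW hn), fun h => (hx m n hmn).1 (congrArg Subtype.val h).symm⟩
    exact nonempty_homeomorph_of_countable_perfect
  · have hsub : pairColours c (Set.range x) ⊆ {i, j} := by
      rintro _ ⟨_, ⟨m, rfl⟩, _, ⟨n, rfl⟩, hne, rfl⟩
      rcases lt_trichotomy m n with h | rfl | h
      · exact (hx m n h).2
      · exact absurd rfl hne
      · rw [Sym2.eq_swap]
        exact (hx n m h).2
    exact (Set.ncard_le_ncard hsub).trans ((Set.ncard_insert_le i {j}).trans (by simp))

end Galvin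
end

section
/- Fix a positive integer K, a set H, a colouring c assigning to every unordered pair of distinct elements of H a colour in {0,…,K−1}, a fine normal ideal I on P_{ω1}(H), sets A, B ∈ I⁺, and a function F : A ∪ B → H such that F(M) ∉ M for every M ∈ A ∪ B. Then for some pair (i,j) with i, j < K, the pair (A,B) is weakly (i,j)-saturated over I. -/
namespace Galvin

theorem IsIdeal.iUnion_mem {H : Type u} {ι : Type*} [Finite ι] {I : Set (Set (Set H))}
    (hI : IsIdeal H I) {S : ι → Set (Set H)} (hS : ∀ i, S i ∈ I) : (⋃ i, S i) ∈ I := by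
  have key : ∀ t : Set ι, t.Finite → (⋃ i ∈ t, S i) ∈ I := by
    intro t ht
    induction t, ht using Set.Finite.induction_on with
    | empty => simpa using hI.empty_mem
    | @insert a s _ _ ih =>
      rw [Set.biUnion_insert]
      exact hI.union_mem _ (hS a) _ ih
  simpa using key Set.univ Set.finite_univ

theorem eIdeal_of_notMem {H : Type u} {I : Set (Set (Set H))} {A : Set (Set H)}
    (hA : A ⊆ Pom H) {φ : Set H → Prop} (h : {M ∈ A | φ M} ∉ I) : eIdeal I A φ := by
  refine ⟨fun M hM => hA hM.1, fun hmem => h ?_⟩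
  have := hmem.2
  rwa [Set.inter_eq_left.mpr (Set.sep_subset A φ)] at this

/-- If `A` minus a null set is covered by finitely many properties, one of them holds for
positively many members of `A`. -/
theorem exists_eIdeal_of_finite_cover {H : Type u} {ι : Type*} [Finite ι]
    {I : Set (Set (Set H))} (hI : IsIdeal H I) {A Z : Set (Set H)} (hA : A ∈ pos H I)
    (hZ : Z ∈ I) {φ : ι → Set H → Prop} (h : ∀ M ∈ A, M ∉ Z → ∃ i, φ i M) :
    ∃ i, eIdeal I A (φ i) := by
  by_contra! hcon
  have hnull : ∀ i, {M ∈ A | φ i M} ∈ I := fun i => by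
    by_contra hi
    exact hcon i (eIdeal_of_notMem hA.1 hi)
  refine hA.2 (hI.subset_mem _ (hI.union_mem _ hZ _ (hI.iUnion_mem hnull)) A fun M hM => ?_)
  by_cases hMZ : M ∈ Z
  · exact Or.inl hMZ
  · obtain ⟨i, hi⟩ := h M hM hMZ
    exact Or.inr (Set.mem_iUnion.mpr ⟨i, hM, hi⟩)

theorem exists_eIdeal_eIdeal {H : Type u} {ι : Type*} [Finite ι] {I : Set (Set (Set H))}
    (hI : IsFineIdeal H I) {A B : Set (Set H)} (hA : A ∈ pos H I) (hB : B ∈ pos H I)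
    {F : Set H → H} (hF : ∀ N ∈ B, F N ∉ N) (d : Set H → Set H → ι) :
    ∃ i, eIdeal I A (fun M => eIdeal I B (fun N => F M ≠ F N ∧ d M N = i)) := by
  refine exists_eIdeal_of_finite_cover hI.1 hA hI.1.empty_mem fun M _ _ => ?_
  refine exists_eIdeal_of_finite_cover hI.1 hB (hI.2.2 (F M)) fun N hN hNM => ?_
  refine ⟨d M N, fun heq => hNM ⟨hB.1 hN, ?_⟩, rfl⟩
  rw [heq]
  exact hF N hN

/-- Lemma 6.2: for a fine normal ideal `I`, `A, B ∈ I⁺`, and `F` with `F(M) ∉ M` on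
`A ∪ B`, the pair `(A, B)` is weakly `(i,j)`-saturated over `I` for some `i, j < K`. -/
theorem exists_weakly_saturated_pair {H : Type u} (K : ℕ) (hK : 0 < K)
    (c : Sym2 H → Fin K) (I : Set (Set (Set H)))
    (hI : IsFineIdeal H I) (hIn : IsNormal H I)
    (A B : Set (Set H)) (hA : A ∈ pos H I) (hB : B ∈ pos H I)
    (F : Set H → H) (hF : ∀ M ∈ A ∪ B, F M ∉ M) :
    ∃ i j : Fin K, WeaklySat c I F A B i j := by
  obtain ⟨i, hi⟩ := exists_eIdeal_eIdeal hI hA hB (fun N hN => hF N (Or.inr hN))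
    (fun M N => c s(F M, F N))
  obtain ⟨j, hj⟩ := exists_eIdeal_eIdeal hI hB hA (fun M hM => hF M (Or.inl hM))
    (fun N M => c s(F M, F N))
  refine ⟨i, j, hi, ?_⟩
  simpa only [ne_comm] using hj

end Galvin
end
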